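/- For every m > 0, the canonical basis elements satisfy the coefficientwise congruences f_{0,m}^{(1)} ≡ f_{0,m}^{(2)} (mod 2^{16}), f_{0,m}^{(1)} ≡ f_{0,m}^{(3)} (mod 3^9), f_{0,m}^{(1)} ≡ f_{0,m}^{(5)} (mod 5^5), and f_{0,m}^{(1)} ≡ f_{0,m}^{(7)} (mod 7^4): i.e., every Fourier coefficient of the difference is divisible by the indicated prime power. -/

import Mathlib

open scoped Manifold
open Complex UpperHalfPlane ModularForm Matrix MatrixGroups

noncomputable def qq (z : ℂ) : ℂ := Complex.exp (2 * Real.pi * Complex.I * z)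

noncomputable def dedekindEta (z : ℂ) : ℂ :=
  Complex.exp (Real.pi * Complex.I * z / 12) * ∏' n : ℕ, (1 - qq ((n + 1) * z))

/-- `f` is a weakly holomorphic modular form of weight `k` on `Γ₀(N)`
whose only possible pole among the cusps is at `∞`. -/
def IsWeaklyHolomorphicSharp (k : ℤ) (N : ℕ) (f : ℍ → ℂ) : Prop :=
  MDifferentiable 𝓘(ℂ) 𝓘(ℂ) f ∧
  (∀ γ ∈ CongruenceSubgroup.Gamma0 N, f ∣[k] γ = f) ∧
  (∀ γ : SL(2, ℤ), ∃ M : ℕ,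
    UpperHalfPlane.IsBoundedAtImInfty (fun z => qq z ^ M * (f ∣[k] γ) z)) ∧
  (∀ γ : SL(2, ℤ), ¬ ((N : ℤ) ∣ (γ : Matrix (Fin 2) (Fin 2) ℤ) 1 0) →
    UpperHalfPlane.IsBoundedAtImInfty (f ∣[k] γ))

/-- `f` additionally vanishes at every cusp other than `∞`. -/
def IsWeaklyHolomorphicSharpCusp (k : ℤ) (N : ℕ) (f : ℍ → ℂ) : Prop :=
  IsWeaklyHolomorphicSharp k N f ∧
  (∀ γ : SL(2, ℤ), ¬ ((N : ℤ) ∣ (γ : Matrix (Fin 2) (Fin 2) ℤ) 1 0) →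
    UpperHalfPlane.IsZeroAtImInfty (f ∣[k] γ))

/-- `f` is the canonical basis element `f_{0,m}^{(N)}` with coefficients `a`. -/
def IsCanonicalBasis0 (N : ℕ) (m : ℕ) (f : ℍ → ℂ) (a : ℕ → ℤ) : Prop :=
  IsWeaklyHolomorphicSharp 0 N f ∧
  ∀ z : ℍ, f z = qq z ^ (-(m : ℤ)) + ∑' n : ℕ, (a (n + 1) : ℂ) * qq z ^ ((n : ℕ) + 1)

noncomputable def Uop (p : ℕ) (f : ℍ → ℂ) : ℍ → ℂ := fun z =>
  (p : ℂ)⁻¹ * ∑ j ∈ Finset.range p, f (((j : ℝ) / p) +ᵥ z)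

noncomputable def Vop (p : ℕ) (f : ℍ → ℂ) : ℍ → ℂ := fun z =>
  if h : 0 < p then
    f ⟨p * z, by simpa using mul_pos (by exact_mod_cast h : (0:ℝ) < p) z.2⟩
  else 0

open Filter Topology

/-- `G` is given near `i∞` by the convergent power series `A` in `q`. -/
def HasQSeries (G : ℍ → ℂ) (A : PowerSeries ℂ) : Prop :=
  ∀ᶠ z : ℍ in atImInfty, HasSum (fun n => PowerSeries.coeff n A * qq z ^ n) (G z)

lemma qq_eq_qParam (z : ℂ) : qq z = Function.Periodic.qParam 1 z := by
  simp [qq, Function.Periodic.qParam]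

lemma qq_ne_zero (z : ℂ) : qq z ≠ 0 := Complex.exp_ne_zero _

lemma norm_qq (z : ℍ) : ‖qq z‖ = Real.exp (-2 * Real.pi * z.im) := by
  rw [qq_eq_qParam, Function.Periodic.norm_qParam]; simp

lemma tendsto_qq : Tendsto (fun z : ℍ => qq z) atImInfty (𝓝 0) := by
  simpa only [qq_eq_qParam] using qParam_tendsto_atImInfty one_pos

lemma eventually_norm_qq_le {r : ℝ} (hr : 0 < r) : ∀ᶠ z : ℍ in atImInfty, ‖qq z‖ ≤ r := by
  have := tendsto_qq.norm
  rw [norm_zero] at this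
  exact (this.eventually (gt_mem_nhds hr)).mono fun z hz => hz.le

lemma HasSum.congr_terms {f g : ℕ → ℂ} {a : ℂ} (hf : HasSum f a) (h : ∀ n, g n = f n) :
    HasSum g a := by
  rwa [funext h]

namespace HasQSeries

variable {G H : ℍ → ℂ} {A B : PowerSeries ℂ}

lemma add (hG : HasQSeries G A) (hH : HasQSeries H B) :
    HasQSeries (fun z => G z + H z) (A + B) := by
  filter_upwards [hG, hH] with z h1 h2
  simpa [add_mul] using h1.add h2

lemma sub (hG : HasQSeries G A) (hH : HasQSeries H B) :
    HasQSeries (fun z => G z - H z) (A - B) := by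
  filter_upwards [hG, hH] with z h1 h2
  simpa [sub_mul] using h1.sub h2

lemma monomial (m : ℕ) : HasQSeries (fun z => qq z ^ m) (PowerSeries.X ^ m) := by
  refine Eventually.of_forall fun z => ?_
  convert hasSum_ite_eq m (qq z ^ m) using 2 with n
  simp only [PowerSeries.coeff_X_pow]
  split_ifs with h <;> simp [h]

lemma const (c : ℂ) : HasQSeries (fun _ => c) (PowerSeries.C c) := by
  refine Eventually.of_forall fun z => ?_
  convert hasSum_ite_eq 0 c using 2 with n
  simp only [PowerSeries.coeff_C]
  split_ifs with h <;> simp [h]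

lemma mul (hG : HasQSeries G A) (hH : HasQSeries H B) :
    HasQSeries (fun z => G z * H z) (A * B) := by
  filter_upwards [hG, hH] with z h1 h2
  have s := summable_norm_sum_mul_antidiagonal_of_summable_norm h1.summable.norm h2.summable.norm
  have e := tsum_mul_tsum_eq_tsum_sum_antidiagonal_of_summable_norm
    h1.summable.norm h2.summable.norm
  rw [h1.tsum_eq, h2.tsum_eq] at e
  rw [e]
  refine s.of_norm.hasSum.congr_terms fun n => ?_
  rw [PowerSeries.coeff_mul, Finset.sum_mul]
  refine Finset.sum_congr rfl fun x hx => ?_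
  rw [← Finset.HasAntidiagonal.mem_antidiagonal.mp hx, pow_add]
  ring

lemma pow (hG : HasQSeries G A) (m : ℕ) : HasQSeries (fun z => G z ^ m) (A ^ m) := by
  induction m with
  | zero => simpa using monomial 0
  | succ m ih => simpa only [pow_succ] using ih.mul hG

lemma sum {ι : Type*} (s : Finset ι) {G : ι → ℍ → ℂ} {A : ι → PowerSeries ℂ}
    (h : ∀ i ∈ s, HasQSeries (G i) (A i)) :
    HasQSeries (fun z => ∑ i ∈ s, G i z) (∑ i ∈ s, A i) := by
  classical
  induction s using Finset.induction_on with
  | empty => simpa using const 0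
  | insert i s hi ih =>
    simp only [Finset.sum_insert hi]
    exact (h i (by simp)).add (ih fun j hj => h j (by simp [hj]))

lemma div_pow {m : ℕ} (hG : HasQSeries G (PowerSeries.X ^ m * A)) :
    HasQSeries (fun z => G z / qq z ^ m) A := by
  filter_upwards [hG] with z h
  rw [← hasSum_nat_add_iff' m] at h
  have h0 : ∑ i ∈ Finset.range m, PowerSeries.coeff i (PowerSeries.X ^ m * A) * qq z ^ i = 0 := by
    refine Finset.sum_eq_zero fun i hi => ?_
    rw [PowerSeries.coeff_X_pow_mul', if_neg (by simpa using hi), zero_mul]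
  rw [h0, sub_zero] at h
  refine (h.div_const (qq z ^ m)).congr_terms fun n => ?_
  rw [PowerSeries.coeff_X_pow_mul', if_pos (by simp), Nat.add_sub_cancel, pow_add]
  field_simp [qq_ne_zero]

lemma congr (hG : HasQSeries G A) (h : ∀ z, G z = H z) : HasQSeries H A := by
  rwa [← show G = H from funext h]

lemma isBoundedAtImInfty (hG : HasQSeries G A) : IsBoundedAtImInfty G := by
  obtain ⟨z₀, hz₀⟩ := hG.exists
  refine isBoundedAtImInfty_iff.mpr ?_
  have h2 := hG.and (eventually_norm_qq_le (norm_pos_iff.mpr (qq_ne_zero z₀)))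
  obtain ⟨R, hR⟩ := (atImInfty_mem _).mp h2
  refine ⟨∑' n, ‖PowerSeries.coeff n A * qq z₀ ^ n‖, R, fun z hz => ?_⟩
  obtain ⟨hs, hle⟩ := hR z hz
  rw [← hs.tsum_eq]
  refine (norm_tsum_le_tsum_norm hs.summable.norm).trans
    (hs.summable.norm.tsum_le_tsum (fun n => ?_) hz₀.summable.norm)
  simp only [norm_mul, norm_pow]
  gcongr

lemma tendsto (hG : HasQSeries G A) :
    Tendsto G atImInfty (𝓝 (PowerSeries.constantCoeff A)) := by
  obtain ⟨B, hB⟩ : PowerSeries.X ∣ A - PowerSeries.C (PowerSeries.constantCoeff A) := by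
    rw [PowerSeries.X_dvd_iff]; simp
  have h1 := hG.sub (const (PowerSeries.constantCoeff A))
  rw [hB, ← pow_one PowerSeries.X] at h1
  have h2 := h1.div_pow.isBoundedAtImInfty
  have h3 : Tendsto (fun z : ℍ => qq z * ((G z - PowerSeries.constantCoeff A) / qq z ^ 1))
      atImInfty (𝓝 0) :=
    tendsto_qq.zero_mul_isBoundedUnder_le
      (by simpa [Function.comp_def] using h2.isBoundedUnder_le)
  have h4 := h3.add_const (PowerSeries.constantCoeff A)
  refine (h4.congr fun z => ?_).trans (by simp)
  field_simp [qq_ne_zero]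
  ring

lemma eq_zero (hA : HasQSeries (fun _ => 0) A) : A = 0 := by
  have key : ∀ n, PowerSeries.X ^ n ∣ A := by
    intro n
    induction n with
    | zero => simp
    | succ n ih =>
      obtain ⟨B, rfl⟩ := ih
      have h1 := hA.div_pow.tendsto
      simp only [zero_div] at h1
      have h2 := tendsto_nhds_unique h1 tendsto_const_nhds
      rw [pow_succ]
      exact mul_dvd_mul_left _ (PowerSeries.X_dvd_iff.mpr h2)
  ext n
  exact PowerSeries.X_pow_dvd_iff.mp (key (n + 1)) n (Nat.lt_succ_self n)

lemma unique (hA : HasQSeries G A) (hB : HasQSeries G B) : A = B := by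
  rw [← sub_eq_zero]
  exact eq_zero ((hA.sub hB).congr fun z => sub_self _)

end HasQSeries

/-- A holomorphic `1`-periodic function bounded at `i∞` has a `q`-series. -/
lemma exists_hasQSeries {G : ℍ → ℂ} (hper : ∀ z : ℍ, G ((1 : ℝ) +ᵥ z) = G z)
    (hG : MDifferentiable 𝓘(ℂ) 𝓘(ℂ) G) (hb : IsBoundedAtImInfty G) :
    ∃ A, HasQSeries G A := by
  have hp : Function.Periodic (G ∘ ofComplex) ((1 : ℝ) : ℂ) := by
    intro w
    by_cases hw : 0 < w.im
    · have h1 : 0 < (w + ((1 : ℝ) : ℂ)).im := by simpa using hw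
      simp only [Function.comp_apply, ofComplex_apply_of_im_pos hw, ofComplex_apply_of_im_pos h1]
      rw [← hper ⟨w, hw⟩]
      congr 1
      ext
      simp [add_comm]
    · have h1 : (w + ((1 : ℝ) : ℂ)).im ≤ 0 := by simpa using hw
      simp only [Function.comp_apply, ofComplex_apply_of_im_nonpos (not_lt.mp hw),
        ofComplex_apply_of_im_nonpos h1]
  refine ⟨qExpansion 1 G, Eventually.of_forall fun z => ?_⟩
  have := hasSum_qExpansion one_pos hp hG hb z
  simpa only [smul_eq_mul, qq_eq_qParam, Complex.ofReal_one] using this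

lemma weight_zero_slash_apply (f : ℍ → ℂ) (γ : SL(2, ℤ)) (z : ℍ) :
    (f ∣[(0 : ℤ)] γ) z = f (γ • z) := by
  rw [ModularForm.SL_slash_apply]; simp

/-- Invariance of a function on the upper half plane under `Γ₀(N)`. -/
def Gamma0Invariant (N : ℕ) (F : ℍ → ℂ) : Prop :=
  ∀ γ ∈ CongruenceSubgroup.Gamma0 N, ∀ z : ℍ, F (γ • z) = F z

lemma Gamma0Invariant.vadd_one {N : ℕ} {F : ℍ → ℂ} (hF : Gamma0Invariant N F) (z : ℍ) :
    F ((1 : ℝ) +ᵥ z) = F z := by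
  have hT : ModularGroup.T ∈ CongruenceSubgroup.Gamma0 N := by
    rw [CongruenceSubgroup.Gamma0_mem]; simp [ModularGroup.T]
  have := modular_T_zpow_smul z 1
  rw [zpow_one, Int.cast_one] at this
  rw [← hF _ hT z, this]

/-- A holomorphic `Γ₀(N)`-invariant function bounded at all cusps is constant. -/
lemma Gamma0Invariant.eq_const {N : ℕ} [NeZero N] {F : ℍ → ℂ} (hF : Gamma0Invariant N F)
    (hol : MDifferentiable 𝓘(ℂ) 𝓘(ℂ) F)
    (hb : ∀ γ : SL(2, ℤ), IsBoundedAtImInfty fun z => F (γ • z)) : ∃ c, ∀ z, F z = c := by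
  let f : ModularForm ((CongruenceSubgroup.Gamma0 N).map (SpecialLinearGroup.mapGL ℝ)) 0 :=
    { toFun := F
      slash_action_eq' := by
        rintro _ ⟨γ, hγ, rfl⟩
        funext z
        exact (weight_zero_slash_apply F γ z).trans (hF γ hγ z)
      holo' := hol
      bdd_at_cusps' := by
        intro c hc
        rw [Subgroup.IsArithmetic.isCusp_iff_isCusp_SL2Z] at hc
        rw [OnePoint.isBoundedAt_iff_forall_SL2Z hc]
        intro γ _
        have : F ∣[(0 : ℤ)] γ = fun z => F (γ • z) := funext (weight_zero_slash_apply F γ)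
        rw [this]
        exact hb γ }
  obtain ⟨c, hc⟩ := ModularForm.eq_const_of_weight_zero f
  exact ⟨c, fun z => congrFun hc z⟩

/-- The map `z ↦ p z` on the upper half plane. -/
noncomputable def dilate (p : ℕ) [NeZero p] (z : ℍ) : ℍ :=
  ⟨p * z, by simpa using mul_pos (by exact_mod_cast NeZero.pos p : (0:ℝ) < p) z.2⟩

/-- The Fricke involution `z ↦ -1 / (p z)`. -/
noncomputable def fricke (p : ℕ) [NeZero p] (z : ℍ) : ℍ := ModularGroup.S • dilate p z

section Fricke

variable {p : ℕ} [NeZero p]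

@[simp] lemma coe_dilate (z : ℍ) : (dilate p z : ℂ) = p * z := rfl

lemma coe_modular_S_smul (z : ℍ) : ((ModularGroup.S • z : ℍ) : ℂ) = -1 / z := by
  rw [coe_specialLinearGroup_apply]; simp [ModularGroup.S]

@[simp] lemma coe_fricke (z : ℍ) : (fricke p z : ℂ) = -1 / (p * z) := by
  rw [fricke, coe_modular_S_smul, coe_dilate]

lemma fricke_fricke (z : ℍ) : fricke p (fricke p z) = z := by
  have := ne_zero z
  have : (p : ℂ) ≠ 0 := NeZero.ne _
  ext
  rw [coe_fricke, coe_fricke]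
  field_simp

lemma dilate_fricke (z : ℍ) : dilate p (fricke p z) = ModularGroup.S • z := by
  have := ne_zero z
  have : (p : ℂ) ≠ 0 := NeZero.ne _
  ext
  rw [coe_dilate, coe_fricke, coe_modular_S_smul]
  field_simp

lemma qq_dilate (z : ℍ) : qq (dilate p z) = qq z ^ p := by
  rw [qq, qq, ← Complex.exp_nat_mul, coe_dilate]
  ring_nf

lemma tendsto_dilate : Tendsto (dilate p) atImInfty atImInfty := by
  have hp : (0 : ℝ) < p := by exact_mod_cast NeZero.pos p
  have h : Tendsto (fun z : ℍ => (p : ℝ) * z.im) atImInfty atTop :=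
    tendsto_comap.const_mul_atTop hp
  refine tendsto_comap_iff.mpr (h.congr fun z => ?_)
  simp [← coe_im]

lemma mdifferentiable_smul_SL (γ : SL(2, ℤ)) :
    MDifferentiable 𝓘(ℂ) 𝓘(ℂ) (fun z : ℍ => γ • z) :=
  mdifferentiable_smul (g := (SpecialLinearGroup.mapGL ℝ γ)) (by simp)

lemma mdifferentiable_dilate : MDifferentiable 𝓘(ℂ) 𝓘(ℂ) (dilate p) := by
  have hp : (0 : ℝ) < p := by exact_mod_cast NeZero.pos p
  let g : GL (Fin 2) ℝ := Matrix.GeneralLinearGroup.mkOfDetNeZero !![(p : ℝ), 0; 0, 1]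
    (by simp [Matrix.det_fin_two, hp.ne'])
  have hg : 0 < g.det.val := by simp [g, Matrix.GeneralLinearGroup.mkOfDetNeZero, hp]
  have : dilate p = fun z : ℍ => g • z := by
    funext z
    ext
    rw [coe_smul_of_det_pos hg]
    simp [num, denom, g, Matrix.GeneralLinearGroup.mkOfDetNeZero]
  rw [this]
  exact mdifferentiable_smul hg

lemma mdifferentiable_fricke : MDifferentiable 𝓘(ℂ) 𝓘(ℂ) (fricke p) :=
  (mdifferentiable_smul_SL ModularGroup.S).comp mdifferentiable_dilate

lemma mem_Gamma0_iff_dvd {N : ℕ} {γ : SL(2, ℤ)} :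
    γ ∈ CongruenceSubgroup.Gamma0 N ↔ (N : ℤ) ∣ γ 1 0 := by
  rw [CongruenceSubgroup.Gamma0_mem, ZMod.intCast_zmod_eq_zero_iff_dvd]

lemma det_SL (γ : SL(2, ℤ)) : γ 0 0 * γ 1 1 - γ 0 1 * γ 1 0 = 1 := by
  rw [← Matrix.det_fin_two]; exact γ.2

lemma coe_SL_smul (γ : SL(2, ℤ)) (z : ℍ) :
    ((γ • z : ℍ) : ℂ) = ((γ 0 0 : ℂ) * z + γ 0 1) / ((γ 1 0 : ℂ) * z + γ 1 1) := by
  rw [coe_specialLinearGroup_apply]; simp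

lemma SL_denom_ne_zero (γ : SL(2, ℤ)) (z : ℍ) : (γ 1 0 : ℂ) * z + γ 1 1 ≠ 0 := by
  simpa [denom] using denom_ne_zero (SpecialLinearGroup.mapGL ℝ γ) z

lemma SL_num_ne_zero (γ : SL(2, ℤ)) (z : ℍ) : (γ 0 0 : ℂ) * z + γ 0 1 ≠ 0 := by
  intro h
  have := ne_zero (γ • z)
  rw [coe_SL_smul, h, zero_div] at this
  exact this rfl

lemma fricke_smul {γ : SL(2, ℤ)} (hγ : γ ∈ CongruenceSubgroup.Gamma0 p) :
    ∃ γ' ∈ CongruenceSubgroup.Gamma0 p, ∀ z : ℍ, fricke p (γ • z) = γ' • fricke p z := by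
  obtain ⟨c, hc⟩ := mem_Gamma0_iff_dvd.mp hγ
  have hdet := det_SL γ
  obtain ⟨γ', h00, h01, h10, h11⟩ : ∃ γ' : SL(2, ℤ),
      γ' 0 0 = γ 1 1 ∧ γ' 0 1 = -c ∧ γ' 1 0 = -(p * γ 0 1) ∧ γ' 1 1 = γ 0 0 :=
    ⟨⟨!![γ 1 1, -c; -(p * γ 0 1), γ 0 0], by
      rw [Matrix.det_fin_two_of]; rw [hc] at hdet; linear_combination hdet⟩, rfl, rfl, rfl, rfl⟩
  refine ⟨γ', ?_, fun z => ?_⟩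
  · rw [mem_Gamma0_iff_dvd, h10]; simp
  · have hz := ne_zero z
    have hp : (p : ℂ) ≠ 0 := NeZero.ne _
    have h1 := SL_denom_ne_zero γ z
    have h2 := SL_num_ne_zero γ z
    ext
    rw [coe_fricke, coe_SL_smul, coe_SL_smul, coe_fricke, h00, h01, h10, h11]
    rw [hc] at h1 ⊢
    push_cast at h1 ⊢
    have h3 : -(p * (γ 0 1 : ℂ)) * (-1 / (p * z)) + γ 0 0 = (γ 0 0 * z + γ 0 1) / z := by
      field_simp; ring
    rw [h3]
    field_simp
    ring

lemma Gamma0Invariant.comp_fricke {F : ℍ → ℂ} (hF : Gamma0Invariant p F) :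
    Gamma0Invariant p (fun z => F (fricke p z)) := by
  intro γ hγ z
  obtain ⟨γ', h1, h2⟩ := fricke_smul hγ
  simp only [h2, hF γ' h1]

/-- For `p` prime, an element of `SL₂(ℤ)` outside `Γ₀(p)` lies in `Γ₀(p) S Tʲ` for some `j`. -/
lemma exists_mul_S_mul_T (hp : p.Prime) {γ : SL(2, ℤ)}
    (hγ : γ ∉ CongruenceSubgroup.Gamma0 p) :
    ∃ γ' ∈ CongruenceSubgroup.Gamma0 p, ∃ j : ℤ,
      γ = γ' * (ModularGroup.S * ModularGroup.T ^ j) := by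
  have : Fact p.Prime := ⟨hp⟩
  rw [CongruenceSubgroup.Gamma0_mem] at hγ
  set x : ZMod p := (γ 1 1 : ZMod p) / (γ 1 0 : ZMod p) with hx
  refine ⟨γ * (ModularGroup.S * ModularGroup.T ^ (x.val : ℤ))⁻¹, ?_, x.val,
    (inv_mul_cancel_right _ _).symm⟩
  rw [CongruenceSubgroup.Gamma0_mem, _root_.mul_inv_rev, ← _root_.zpow_neg]
  have hS : ((ModularGroup.S⁻¹ : SL(2, ℤ)) : Matrix (Fin 2) (Fin 2) ℤ) = !![0, 1; -1, 0] := by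
    rw [Matrix.SpecialLinearGroup.SL2_inv_expl]
    simp [ModularGroup.S]
    rfl
  simp only [Matrix.SpecialLinearGroup.coe_mul, ModularGroup.coe_T_zpow, hS]
  simp [Matrix.mul_apply, Fin.sum_univ_two]
  rw [hx]
  field_simp
  ring

/-- A holomorphic `Γ₀(p)`-invariant function bounded at `i∞` together with its Fricke transform
is constant. -/
lemma Gamma0Invariant.eq_const_of_fricke (hp : p.Prime) {F : ℍ → ℂ} (hF : Gamma0Invariant p F)
    (hol : MDifferentiable 𝓘(ℂ) 𝓘(ℂ) F) (h1 : IsBoundedAtImInfty F)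
    (h2 : IsBoundedAtImInfty fun z => F (fricke p z)) : ∃ c, ∀ z, F z = c := by
  refine hF.eq_const hol fun γ => ?_
  by_cases hγ : γ ∈ CongruenceSubgroup.Gamma0 p
  · simpa only [hF γ hγ] using h1
  obtain ⟨γ', hγ', j, rfl⟩ := exists_mul_S_mul_T hp hγ
  have hp0 : (0 : ℝ) < p := by exact_mod_cast hp.pos
  obtain ⟨M, A, hM⟩ := isBoundedAtImInfty_iff.mp h2
  refine isBoundedAtImInfty_iff.mpr ⟨M, A * p, fun z hz => ?_⟩
  rw [mul_smul, hF γ' hγ', mul_smul, modular_T_zpow_smul]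
  let w : ℍ := ⟨((j : ℝ) +ᵥ z : ℍ) / p, by
    rw [← Complex.ofReal_natCast, Complex.div_ofReal_im]; exact div_pos (im_pos _) hp0⟩
  have hw : dilate p w = (j : ℝ) +ᵥ z := by
    ext
    have : (p : ℂ) ≠ 0 := NeZero.ne _
    simp only [coe_dilate, w]
    field_simp
  have := hM w (by
    have : w.im = z.im / p := by
      rw [← coe_im]; simp only [w]
      rw [← Complex.ofReal_natCast, Complex.div_ofReal_im]; simp
    rw [this, le_div_iff₀ hp0]; exact hz)
  rwa [fricke, hw] at this

end Fricke

namespace UpperHalfPlane.IsBoundedAtImInfty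

variable {F G : ℍ → ℂ}

lemma fun_mul (hF : IsBoundedAtImInfty F) (hG : IsBoundedAtImInfty G) :
    IsBoundedAtImInfty fun z => F z * G z :=
  BoundedAtFilter.mul hF hG

lemma fun_add (hF : IsBoundedAtImInfty F) (hG : IsBoundedAtImInfty G) :
    IsBoundedAtImInfty fun z => F z + G z :=
  BoundedAtFilter.add hF hG

lemma fun_sub (hF : IsBoundedAtImInfty F) (hG : IsBoundedAtImInfty G) :
    IsBoundedAtImInfty fun z => F z - G z := by
  have := hF.fun_add (BoundedAtFilter.neg hG)
  simpa only [sub_eq_add_neg, Pi.neg_apply] using this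

lemma const (c : ℂ) : IsBoundedAtImInfty fun _ => c :=
  const_boundedAtFilter _ c

lemma fun_pow (hF : IsBoundedAtImInfty F) (n : ℕ) : IsBoundedAtImInfty fun z => F z ^ n := by
  induction n with
  | zero => simpa using const 1
  | succ n ih => simpa only [pow_succ] using ih.fun_mul hF

lemma fun_sum {ι : Type*} (s : Finset ι) {F : ι → ℍ → ℂ}
    (h : ∀ i ∈ s, IsBoundedAtImInfty (F i)) : IsBoundedAtImInfty fun z => ∑ i ∈ s, F i z := by
  classical
  induction s using Finset.induction_on with
  | empty => simpa using const 0
  | insert i s hi ih =>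
    simp only [Finset.sum_insert hi]
    exact (h i (by simp)).fun_add (ih fun j hj => h j (by simp [hj]))

end UpperHalfPlane.IsBoundedAtImInfty

namespace Gamma0Invariant

variable {N : ℕ} {F G : ℍ → ℂ}

lemma mul (hF : Gamma0Invariant N F) (hG : Gamma0Invariant N G) :
    Gamma0Invariant N fun z => F z * G z := fun γ hγ z => by
  simp only [hF γ hγ, hG γ hγ]

lemma sub (hF : Gamma0Invariant N F) (hG : Gamma0Invariant N G) :
    Gamma0Invariant N fun z => F z - G z := fun γ hγ z => by
  simp only [hF γ hγ, hG γ hγ]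

lemma const (c : ℂ) : Gamma0Invariant N fun _ => c := fun _ _ _ => rfl

lemma pow (hF : Gamma0Invariant N F) (n : ℕ) : Gamma0Invariant N fun z => F z ^ n :=
  fun γ hγ z => by simp only [hF γ hγ]

lemma sum {ι : Type*} (s : Finset ι) {F : ι → ℍ → ℂ} (h : ∀ i ∈ s, Gamma0Invariant N (F i)) :
    Gamma0Invariant N fun z => ∑ i ∈ s, F i z := fun γ hγ z =>
  Finset.sum_congr rfl fun i hi => h i hi γ hγ z

end Gamma0Invariant

/-- The power series `q ^ m f` for `f = q ^ (-m) + ∑_{n ≥ 1} a n q ^ n`. -/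
noncomputable def canonicalSeries (m : ℕ) (a : ℕ → ℤ) : PowerSeries ℤ :=
  1 + PowerSeries.X ^ (m + 1) * PowerSeries.mk fun n => a (n + 1)

/-- The base change of power series from `ℤ` to `ℂ`. -/
noncomputable abbrev toComplexSeries : PowerSeries ℤ →+* PowerSeries ℂ :=
  PowerSeries.map (Int.castRingHom ℂ)

lemma toComplexSeries_injective : Function.Injective toComplexSeries :=
  PowerSeries.map_injective _ Int.cast_injective

namespace IsCanonicalBasis0

variable {N m : ℕ} {f : ℍ → ℂ} {a : ℕ → ℤ}

lemma gamma0Invariant (h : IsCanonicalBasis0 N m f a) : Gamma0Invariant N f := fun γ hγ z => by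
  rw [← weight_zero_slash_apply f, h.1.2.1 γ hγ]

lemma isBoundedAtImInfty_smul (h : IsCanonicalBasis0 N m f a) {γ : SL(2, ℤ)}
    (hγ : γ ∉ CongruenceSubgroup.Gamma0 N) : IsBoundedAtImInfty fun z => f (γ • z) := by
  rw [mem_Gamma0_iff_dvd] at hγ
  refine (h.1.2.2.2 γ hγ).congr_left fun z => ?_
  rw [weight_zero_slash_apply]

/-- The Fourier series of a canonical basis element converges somewhere: otherwise the junk value
of the infinite sum would make `q ^ (-m)` invariant under `Γ₀(N)`. -/
lemma exists_summable [NeZero N] (hm : m ≠ 0) (h : IsCanonicalBasis0 N m f a) :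
    ∃ z : ℍ, Summable fun n => (a (n + 1) : ℂ) * qq z ^ (n + 1) := by
  by_contra! H
  have hf : ∀ z : ℍ, f z = qq z ^ (-(m : ℤ)) := fun z => by
    rw [h.2 z, tsum_eq_zero_of_not_summable (H z), add_zero]
  obtain ⟨γ, h00, h01, h10, h11⟩ : ∃ γ : SL(2, ℤ),
      γ 0 0 = 1 ∧ γ 0 1 = 0 ∧ γ 1 0 = N ∧ γ 1 1 = 1 :=
    ⟨⟨!![1, 0; N, 1], by simp⟩, rfl, rfl, rfl, rfl⟩
  have hγ : γ ∈ CongruenceSubgroup.Gamma0 N := by rw [mem_Gamma0_iff_dvd, h10]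
  have e := h.gamma0Invariant γ hγ I
  rw [hf, hf, _root_.zpow_neg, _root_.zpow_neg, _root_.inv_inj, zpow_natCast, zpow_natCast] at e
  have e1 := (pow_left_inj₀ (norm_nonneg _) (norm_nonneg _) hm).mp
    (by simpa only [norm_pow] using congrArg norm e)
  have e2 : (γ • UpperHalfPlane.I).im = 1 := by
    rw [norm_qq, norm_qq, Real.exp_eq_exp] at e1
    simpa [Real.pi_ne_zero] using e1
  rw [← coe_im, coe_SL_smul, h00, h01, h10, h11] at e2
  simp [Complex.div_im, Complex.normSq_apply] at e2
  exact NeZero.ne N e2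

lemma hasQSeries [NeZero N] (hm : m ≠ 0) (h : IsCanonicalBasis0 N m f a) :
    HasQSeries (fun z => qq z ^ m * f z) (toComplexSeries (canonicalSeries m a)) := by
  have hs : HasQSeries (fun z => ∑' n, (a (n + 1) : ℂ) * qq z ^ n)
      (PowerSeries.mk fun n => (a (n + 1) : ℂ)) := by
    obtain ⟨w, hw⟩ := h.exists_summable hm
    have hw' : Summable fun n => (a (n + 1) : ℂ) * qq w ^ n := by
      refine (hw.mul_right (qq w)⁻¹).congr fun n => ?_
      have := qq_ne_zero w
      field_simp
      ring
    have hr : 0 < ‖qq w‖ / 2 := by have := norm_pos_iff.mpr (qq_ne_zero w); positivity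
    filter_upwards [eventually_norm_qq_le hr] with z hz
    have := summable_powerSeries_of_norm_lt hw'.hasSum.tendsto_sum_nat.cauchySeq
      (z := qq z) (by linarith)
    simpa only [PowerSeries.coeff_mk] using this.hasSum
  have e : toComplexSeries (canonicalSeries m a) = PowerSeries.C 1 +
      PowerSeries.X ^ (m + 1) * PowerSeries.mk fun n => (a (n + 1) : ℂ) := by
    simp only [canonicalSeries, map_add, map_mul, map_pow, map_one, PowerSeries.map_X]
    rfl
  rw [e]
  refine ((HasQSeries.const 1).add ((HasQSeries.monomial (m + 1)).mul hs)).congr fun z => ?_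
  have hq := qq_ne_zero z
  rw [h.2 z, mul_add, _root_.zpow_neg, zpow_natCast, mul_inv_cancel₀ (pow_ne_zero _ hq), pow_succ,
    mul_assoc, ← tsum_mul_left]
  simp only [pow_succ, mul_comm, mul_assoc]

end IsCanonicalBasis0

namespace IsCanonicalBasis0

variable {N : ℕ} [NeZero N] {f : ℕ → ℍ → ℂ} {a : ℕ → ℕ → ℤ}

/-- The product of the first with the `m`-th canonical basis element is a combination of canonical
basis elements and a constant. -/
lemma exists_recursion (h : ∀ m, IsCanonicalBasis0 N m (f m) (a m)) {m : ℕ} (hm : m ≠ 0) :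
    ∃ e : ℤ, canonicalSeries 1 (a 1) * canonicalSeries m (a m) =
      canonicalSeries (m + 1) (a (m + 1)) +
      ∑ i ∈ Finset.range (m - 1), PowerSeries.C (a 1 (i + 1)) * PowerSeries.X ^ (i + 2) *
        canonicalSeries (m - 1 - i) (a (m - 1 - i)) +
      PowerSeries.C e * PowerSeries.X ^ (m + 1) := by
  let D : ℍ → ℂ := fun z => f 1 z * f m z - f (m + 1) z -
    ∑ i ∈ Finset.range (m - 1), (a 1 (i + 1) : ℂ) * f (m - 1 - i) z
  let E : PowerSeries ℤ := canonicalSeries 1 (a 1) * canonicalSeries m (a m) -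
    canonicalSeries (m + 1) (a (m + 1)) -
    ∑ i ∈ Finset.range (m - 1), PowerSeries.C (a 1 (i + 1)) * PowerSeries.X ^ (i + 2) *
      canonicalSeries (m - 1 - i) (a (m - 1 - i))
  obtain ⟨E', hE'⟩ : PowerSeries.X ^ (m + 1) ∣ E := by
    have h1 : PowerSeries.X ^ (m + 1) ∣ (PowerSeries.X ^ 2 * PowerSeries.mk fun n => a 1 (n + 1)) -
        ∑ i ∈ Finset.range (m - 1), PowerSeries.C (a 1 (i + 1)) * PowerSeries.X ^ (i + 2) := by
      refine PowerSeries.X_pow_dvd_iff.mpr fun n hn => ?_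
      rw [map_sub, map_sum, PowerSeries.coeff_X_pow_mul']
      simp only [PowerSeries.coeff_C_mul, PowerSeries.coeff_X_pow, PowerSeries.coeff_mk]
      rcases n with _ | _ | n
      · simp
      · simp
      · have : n < m - 1 := by omega
        simp [this]
    have h2 : E = ((PowerSeries.X ^ 2 * PowerSeries.mk fun n => a 1 (n + 1)) -
        ∑ i ∈ Finset.range (m - 1), PowerSeries.C (a 1 (i + 1)) * PowerSeries.X ^ (i + 2)) +
        PowerSeries.X ^ (m + 1) * (canonicalSeries 1 (a 1) * (PowerSeries.mk fun n => a m (n + 1)) -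
          PowerSeries.X * PowerSeries.mk fun n => a (m + 1) (n + 1)) -
        ∑ i ∈ Finset.range (m - 1), PowerSeries.X ^ (m + 1) * (PowerSeries.C (a 1 (i + 1)) *
          PowerSeries.X * PowerSeries.mk fun n => a (m - 1 - i) (n + 1)) := by
      have h3 : ∑ i ∈ Finset.range (m - 1), PowerSeries.C (a 1 (i + 1)) * PowerSeries.X ^ (i + 2) *
            canonicalSeries (m - 1 - i) (a (m - 1 - i)) =
          ∑ i ∈ Finset.range (m - 1), PowerSeries.C (a 1 (i + 1)) * PowerSeries.X ^ (i + 2) +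
          ∑ i ∈ Finset.range (m - 1), PowerSeries.X ^ (m + 1) * (PowerSeries.C (a 1 (i + 1)) *
            PowerSeries.X * PowerSeries.mk fun n => a (m - 1 - i) (n + 1)) := by
        rw [← Finset.sum_add_distrib]
        refine Finset.sum_congr rfl fun i hi => ?_
        rw [Finset.mem_range] at hi
        obtain ⟨k, rfl⟩ : ∃ k, m = i + 2 + k := ⟨m - 1 - i - 1, by omega⟩
        rw [show i + 2 + k - 1 - i = k + 1 by omega, canonicalSeries]
        ring
      simp only [E]
      rw [h3]
      simp only [canonicalSeries]
      ring
    rw [h2]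
    exact dvd_sub (dvd_add h1 (dvd_mul_right _ _))
      (Finset.dvd_sum fun i _ => dvd_mul_right _ _)
  have hDE : HasQSeries D (toComplexSeries E') := by
    have h1 : HasQSeries (fun z => (qq z ^ 1 * f 1 z) * (qq z ^ m * f m z) -
        qq z ^ (m + 1) * f (m + 1) z - ∑ i ∈ Finset.range (m - 1),
          (a 1 (i + 1) : ℂ) * qq z ^ (i + 2) * (qq z ^ (m - 1 - i) * f (m - 1 - i) z))
        (toComplexSeries E) := by
      simp only [E, map_sub, map_mul, map_sum, map_pow, PowerSeries.map_X, PowerSeries.map_C]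
      refine ((((h 1).hasQSeries one_ne_zero).mul ((h m).hasQSeries hm)).sub
        ((h (m + 1)).hasQSeries m.succ_ne_zero)).sub (HasQSeries.sum _ fun i hi => ?_)
      rw [Finset.mem_range] at hi
      exact ((HasQSeries.const _).mul (HasQSeries.monomial _)).mul
        ((h (m - 1 - i)).hasQSeries (by omega))
    rw [hE', map_mul, map_pow, PowerSeries.map_X] at h1
    refine h1.div_pow.congr fun z => ?_
    have hq := qq_ne_zero z
    rw [div_eq_iff (pow_ne_zero _ hq), sub_mul, sub_mul, Finset.sum_mul]
    congr 1
    · ring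
    · refine Finset.sum_congr rfl fun i hi => ?_
      rw [Finset.mem_range] at hi
      rw [show m + 1 = (i + 2) + (m - 1 - i) by omega, pow_add]
      ring
  have hinv : Gamma0Invariant N D := (((h 1).gamma0Invariant.mul (h m).gamma0Invariant).sub
    (h (m + 1)).gamma0Invariant).sub (Gamma0Invariant.sum _ fun i _ =>
      (Gamma0Invariant.const _).mul (h _).gamma0Invariant)
  have hol : MDifferentiable 𝓘(ℂ) 𝓘(ℂ) D := by
    refine (((h 1).1.1.mul (h m).1.1).sub (h (m + 1)).1.1).sub ?_
    have := MDifferentiable.sum (t := Finset.range (m - 1)) (I := 𝓘(ℂ))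
      (f := fun i z => (a 1 (i + 1) : ℂ) * f (m - 1 - i) z)
      fun i _ => mdifferentiable_const.mul (h (m - 1 - i)).1.1
    rwa [Finset.sum_fn] at this
  obtain ⟨c, hc⟩ := hinv.eq_const hol fun γ => by
    by_cases hγ : γ ∈ CongruenceSubgroup.Gamma0 N
    · simpa only [hinv γ hγ] using hDE.isBoundedAtImInfty
    · exact ((((h 1).isBoundedAtImInfty_smul hγ).fun_mul ((h m).isBoundedAtImInfty_smul hγ)).fun_sub
        ((h (m + 1)).isBoundedAtImInfty_smul hγ)).fun_sub (IsBoundedAtImInfty.fun_sum _ fun i _ =>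
          (IsBoundedAtImInfty.const _).fun_mul ((h _).isBoundedAtImInfty_smul hγ))
  have hE'c : toComplexSeries E' = PowerSeries.C c :=
    hDE.unique ((HasQSeries.const c).congr fun z => (hc z).symm)
  have hE'e : E' = PowerSeries.C (PowerSeries.constantCoeff E') := by
    ext n
    rcases n with _ | n
    · simp
    · have := congrArg (PowerSeries.coeff (n + 1)) hE'c
      rw [PowerSeries.coeff_map, PowerSeries.coeff_succ_C, eq_intCast, Int.cast_eq_zero] at this
      rw [this, PowerSeries.coeff_succ_C]
  refine ⟨PowerSeries.constantCoeff E', ?_⟩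
  rw [← hE'e, mul_comm E', ← hE']
  simp only [E]
  ring

end IsCanonicalBasis0

lemma coeff_canonicalSeries_self {m : ℕ} (hm : m ≠ 0) (a : ℕ → ℤ) :
    PowerSeries.coeff m (canonicalSeries m a) = 0 := by
  rw [canonicalSeries, map_add, PowerSeries.coeff_X_pow_mul', if_neg (by omega),
    PowerSeries.coeff_one, if_neg hm, add_zero]

lemma coeff_canonicalSeries_add (m n : ℕ) (a : ℕ → ℤ) :
    PowerSeries.coeff (m + (n + 1)) (canonicalSeries m a) = a (n + 1) := by
  rw [canonicalSeries, map_add, PowerSeries.coeff_X_pow_mul', if_pos (by omega),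
    PowerSeries.coeff_one, if_neg (by omega), zero_add, PowerSeries.coeff_mk]
  congr 2
  omega

/-- Reduction of integral power series modulo `M`. -/
noncomputable abbrev reduceSeries (M : ℕ) : PowerSeries ℤ →+* PowerSeries (ZMod M) :=
  PowerSeries.map (Int.castRingHom (ZMod M))

/-- A congruence between the first canonical basis elements of two levels propagates to all of
them. -/
lemma IsCanonicalBasis0.reduceSeries_eq {M N N' : ℕ} [NeZero N] [NeZero N']
    {f f' : ℕ → ℍ → ℂ} {a a' : ℕ → ℕ → ℤ}
    (h : ∀ m, IsCanonicalBasis0 N m (f m) (a m)) (h' : ∀ m, IsCanonicalBasis0 N' m (f' m) (a' m))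
    (base : reduceSeries M (canonicalSeries 1 (a 1)) = reduceSeries M (canonicalSeries 1 (a' 1)))
    {m : ℕ} (hm : m ≠ 0) :
    reduceSeries M (canonicalSeries m (a m)) = reduceSeries M (canonicalSeries m (a' m)) := by
  induction m using Nat.strong_induction_on with
  | _ m ih =>
    rcases m with _ | _ | k
    · exact absurd rfl hm
    · exact base
    have ha : ∀ i, Int.castRingHom (ZMod M) (a 1 (i + 1)) = Int.castRingHom (ZMod M) (a' 1 (i + 1)) :=
      fun i => by
        simpa only [PowerSeries.coeff_map, coeff_canonicalSeries_add] using
          congrArg (PowerSeries.coeff (1 + (i + 1))) base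
    obtain ⟨e, he⟩ := exists_recursion h k.succ_ne_zero
    obtain ⟨e', he'⟩ := exists_recursion h' k.succ_ne_zero
    replace he := congrArg (reduceSeries M) he
    replace he' := congrArg (reduceSeries M) he'
    simp only [map_add, map_mul, map_sum, map_pow, PowerSeries.map_X, PowerSeries.map_C] at he he'
    have hsum : ∑ i ∈ Finset.range (k + 1 - 1),
          PowerSeries.C (Int.castRingHom (ZMod M) (a 1 (i + 1))) * PowerSeries.X ^ (i + 2) *
            reduceSeries M (canonicalSeries (k + 1 - 1 - i) (a (k + 1 - 1 - i))) =
        ∑ i ∈ Finset.range (k + 1 - 1),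
          PowerSeries.C (Int.castRingHom (ZMod M) (a' 1 (i + 1))) * PowerSeries.X ^ (i + 2) *
            reduceSeries M (canonicalSeries (k + 1 - 1 - i) (a' (k + 1 - 1 - i))) := by
      refine Finset.sum_congr rfl fun i hi => ?_
      rw [Finset.mem_range] at hi
      rw [ha, ih (k + 1 - 1 - i) (by omega) (by omega)]
    rw [hsum, base, ih (k + 1) (by omega) (by omega), he'] at he
    have hc : ∀ b : ℕ → ℤ, PowerSeries.coeff (k + 1 + 1) (reduceSeries M
        (canonicalSeries (k + 1 + 1) b)) = 0 := fun b => by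
      rw [PowerSeries.coeff_map, coeff_canonicalSeries_self (by omega), map_zero]
    have hee := congrArg (PowerSeries.coeff (k + 1 + 1)) he
    simp only [map_add, hc, PowerSeries.coeff_C_mul, PowerSeries.coeff_X_pow, if_true, mul_one,
      zero_add, add_right_inj] at hee
    rw [hee] at he
    exact (add_right_cancel (add_right_cancel he)).symm

lemma IsCanonicalBasis0.dvd_sub {M N N' : ℕ} [NeZero N] [NeZero N']
    {f f' : ℕ → ℍ → ℂ} {a a' : ℕ → ℕ → ℤ}
    (h : ∀ m, IsCanonicalBasis0 N m (f m) (a m)) (h' : ∀ m, IsCanonicalBasis0 N' m (f' m) (a' m))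
    (base : reduceSeries M (canonicalSeries 1 (a 1)) = reduceSeries M (canonicalSeries 1 (a' 1)))
    {m n : ℕ} (hm : 0 < m) (hn : 1 ≤ n) : (M : ℤ) ∣ a m n - a' m n := by
  obtain ⟨n, rfl⟩ := Nat.exists_eq_add_of_le' hn
  have := congrArg (PowerSeries.coeff (m + (n + 1))) (reduceSeries_eq h h' base hm.ne')
  simp only [PowerSeries.coeff_map, coeff_canonicalSeries_add, eq_intCast] at this
  exact (ZMod.intCast_eq_intCast_iff_dvd_sub _ _ _).mp this.symm

lemma ModularForm.hasQSeries {k : ℤ} (f : ModularForm 𝒮ℒ k) : HasQSeries f (qExpansion 1 f) := by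
  refine Eventually.of_forall fun z => ?_
  have := ModularForm.hasSum_qExpansion f one_pos one_mem_strictPeriods_SL z
  simpa only [smul_eq_mul, qq_eq_qParam, Complex.ofReal_one] using this

/-- The beginning of the `q`-expansion of `Δ / q`. -/
noncomputable def discriminantTrunc : PowerSeries ℤ :=
  1 - 24 * PowerSeries.X + 252 * PowerSeries.X ^ 2 - 1472 * PowerSeries.X ^ 3 +
    4830 * PowerSeries.X ^ 4 - 6048 * PowerSeries.X ^ 5 - 16744 * PowerSeries.X ^ 6

lemma E₄_qExpansion_mod : PowerSeries.X ^ 8 ∣ qExpansion 1 E₄ -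
    (1 + 240 * PowerSeries.X + 2160 * PowerSeries.X ^ 2 + 6720 * PowerSeries.X ^ 3 +
      17520 * PowerSeries.X ^ 4 + 30240 * PowerSeries.X ^ 5 + 60480 * PowerSeries.X ^ 6 +
      82560 * PowerSeries.X ^ 7) := by
  have hb : bernoulli 4 = -1 / 30 := by decide +kernel
  have hs : ArithmeticFunction.sigma 3 2 = 9 ∧ ArithmeticFunction.sigma 3 3 = 28 ∧
      ArithmeticFunction.sigma 3 4 = 73 ∧ ArithmeticFunction.sigma 3 5 = 126 ∧
      ArithmeticFunction.sigma 3 6 = 252 ∧ ArithmeticFunction.sigma 3 7 = 344 := by decide +kernel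
  refine PowerSeries.X_pow_dvd_iff.mpr fun n hn => ?_
  rw [map_sub, EisensteinSeries.E_qExpansion_coeff _ ⟨2, rfl⟩, hb]
  simp only [map_add, ← map_ofNat (PowerSeries.C (R := ℂ)), PowerSeries.coeff_C_mul,
    PowerSeries.coeff_X_pow, PowerSeries.coeff_X, PowerSeries.coeff_one]
  interval_cases n <;> norm_num [hs]

lemma E₆_qExpansion_mod : PowerSeries.X ^ 8 ∣ qExpansion 1 E₆ -
    (1 - 504 * PowerSeries.X - 16632 * PowerSeries.X ^ 2 - 122976 * PowerSeries.X ^ 3 -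
      532728 * PowerSeries.X ^ 4 - 1575504 * PowerSeries.X ^ 5 - 4058208 * PowerSeries.X ^ 6 -
      8471232 * PowerSeries.X ^ 7) := by
  have hb : bernoulli 6 = 1 / 42 := by decide +kernel
  have hs : ArithmeticFunction.sigma 5 2 = 33 ∧ ArithmeticFunction.sigma 5 3 = 244 ∧
      ArithmeticFunction.sigma 5 4 = 1057 ∧ ArithmeticFunction.sigma 5 5 = 3126 ∧
      ArithmeticFunction.sigma 5 6 = 8052 ∧ ArithmeticFunction.sigma 5 7 = 16808 := by decide +kernel
  refine PowerSeries.X_pow_dvd_iff.mpr fun n hn => ?_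
  rw [map_sub, EisensteinSeries.E_qExpansion_coeff _ ⟨3, rfl⟩, hb]
  simp only [map_sub, ← map_ofNat (PowerSeries.C (R := ℂ)), PowerSeries.coeff_C_mul,
    PowerSeries.coeff_X_pow, PowerSeries.coeff_X, PowerSeries.coeff_one]
  interval_cases n <;> norm_num [hs]

lemma exists_hasQSeries_discriminant : ∃ B : PowerSeries ℂ,
    HasQSeries (fun z => discriminant z / qq z)
      (toComplexSeries discriminantTrunc + PowerSeries.X ^ 7 * B) := by
  have h := (HasQSeries.const (1 / 1728)).mul
    (((ModularForm.hasQSeries E₄).pow 3).sub ((ModularForm.hasQSeries E₆).pow 2))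
  obtain ⟨r, hr⟩ := E₄_qExpansion_mod.trans (sub_dvd_pow_sub_pow _ _ 3)
  obtain ⟨s, hs⟩ := E₆_qExpansion_mod.trans (sub_dvd_pow_sub_pow _ _ 2)
  set P4 : PowerSeries ℂ := 1 + 240 * PowerSeries.X + 2160 * PowerSeries.X ^ 2 +
    6720 * PowerSeries.X ^ 3 + 17520 * PowerSeries.X ^ 4 + 30240 * PowerSeries.X ^ 5 +
    60480 * PowerSeries.X ^ 6 + 82560 * PowerSeries.X ^ 7 with hP4
  set P6 : PowerSeries ℂ := 1 - 504 * PowerSeries.X - 16632 * PowerSeries.X ^ 2 -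
    122976 * PowerSeries.X ^ 3 - 532728 * PowerSeries.X ^ 4 - 1575504 * PowerSeries.X ^ 5 -
    4058208 * PowerSeries.X ^ 6 - 8471232 * PowerSeries.X ^ 7 with hP6
  obtain ⟨S, key⟩ : ∃ S, P4 ^ 3 - P6 ^ 2 = 1728 * (PowerSeries.X * toComplexSeries discriminantTrunc) +
      PowerSeries.X ^ 8 * S := by
    refine ⟨111464640 + 16725318912 * PowerSeries.X +
        570553327872 * PowerSeries.X ^ 2 + 4763657170944 * PowerSeries.X ^ 3 +
        23362024596480 * PowerSeries.X ^ 4 + 80141724684288 * PowerSeries.X ^ 5 +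
        227327535230976 * PowerSeries.X ^ 6 + 539959468032000 * PowerSeries.X ^ 7 +
        866114519040000 * PowerSeries.X ^ 8 + 1220633100288000 * PowerSeries.X ^ 9 +
        1485454049280000 * PowerSeries.X ^ 10 + 1524332888064000 * PowerSeries.X ^ 11 +
        1236722909184000 * PowerSeries.X ^ 12 + 562741641216000 * PowerSeries.X ^ 13, ?_⟩
    simp only [discriminantTrunc, map_sub, map_add, map_mul, map_pow, map_one, map_ofNat,
      PowerSeries.map_X, hP4, hP6]
    ring
  have hC : (PowerSeries.C (1 / 1728) : PowerSeries ℂ) * 1728 = 1 := by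
    rw [← map_ofNat (PowerSeries.C (R := ℂ)), ← map_mul]; norm_num
  have e : PowerSeries.C (1 / 1728) * (qExpansion 1 E₄ ^ 3 - qExpansion 1 E₆ ^ 2) =
      PowerSeries.X ^ 1 * (toComplexSeries discriminantTrunc +
        PowerSeries.X ^ 7 * (PowerSeries.C (1 / 1728) * (S + r - s))) := by
    linear_combination PowerSeries.C (1 / 1728) * (key + hr - hs) +
      PowerSeries.X * toComplexSeries discriminantTrunc * hC
  rw [e] at h
  refine ⟨_, h.div_pow.congr fun z => ?_⟩
  rw [discriminant_eq_E₄_cube_sub_E₆_sq, pow_one]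
  ring

lemma HasQSeries.comp_dilate {p : ℕ} [NeZero p] {G : ℍ → ℂ} {A : PowerSeries ℂ}
    (hG : HasQSeries G A) :
    HasQSeries (fun z => G (dilate p z)) (PowerSeries.expand p (NeZero.ne p) A) := by
  filter_upwards [(tendsto_dilate (p := p)).eventually hG] with z hz
  have hinj : Function.Injective fun n : ℕ => p * n := mul_right_injective₀ (NeZero.ne p)
  rw [← hinj.hasSum_iff]
  · refine hz.congr_terms fun n => ?_
    simp only [Function.comp_apply, PowerSeries.coeff_expand_mul, qq_dilate, pow_mul]
  · intro n hn
    rw [PowerSeries.coeff_expand_of_not_dvd _ _ _ fun ⟨m, hm⟩ => hn ⟨m, hm.symm⟩, zero_mul]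

lemma discriminant_smul (γ : SL(2, ℤ)) (z : ℍ) :
    discriminant (γ • z) = ((γ 1 0 : ℂ) * z + γ 1 1) ^ 12 * discriminant z := by
  have h := congrFun (CuspForm.discriminant.slash_action_eq' (SpecialLinearGroup.mapGL ℝ γ)
    ⟨γ, rfl⟩) z
  change (discriminant ∣[(12 : ℤ)] γ) z = discriminant z at h
  have hd : denom (SpecialLinearGroup.toGL ((SpecialLinearGroup.map (Int.castRingHom ℝ)) γ)) z =
      (γ 1 0 : ℂ) * z + γ 1 1 := by simp [denom]
  rw [ModularForm.SL_slash_apply, hd, _root_.zpow_neg, ← div_eq_mul_inv,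
    div_eq_iff (zpow_ne_zero _ (SL_denom_ne_zero γ z))] at h
  rw [h, mul_comm]
  rfl

/-- The quotient `Δ(p z) / Δ(z)`. -/
noncomputable def discriminantQuotient (p : ℕ) [NeZero p] (z : ℍ) : ℂ :=
  discriminant (dilate p z) / discriminant z

section DiscriminantQuotient

variable {p : ℕ} [NeZero p]

lemma dilate_smul {γ : SL(2, ℤ)} (hγ : γ ∈ CongruenceSubgroup.Gamma0 p) :
    ∃ γ' : SL(2, ℤ), (p : ℤ) * γ' 1 0 = γ 1 0 ∧ γ' 1 1 = γ 1 1 ∧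
      ∀ z : ℍ, dilate p (γ • z) = γ' • dilate p z := by
  obtain ⟨c, hc⟩ := mem_Gamma0_iff_dvd.mp hγ
  have hdet := det_SL γ
  obtain ⟨γ', h00, h01, h10, h11⟩ : ∃ γ' : SL(2, ℤ),
      γ' 0 0 = γ 0 0 ∧ γ' 0 1 = p * γ 0 1 ∧ γ' 1 0 = c ∧ γ' 1 1 = γ 1 1 :=
    ⟨⟨!![γ 0 0, p * γ 0 1; c, γ 1 1], by
      rw [Matrix.det_fin_two_of]; rw [hc] at hdet; linear_combination hdet⟩, rfl, rfl, rfl, rfl⟩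
  refine ⟨γ', by rw [h10, hc], h11, fun z => ?_⟩
  ext
  rw [coe_dilate, coe_SL_smul, coe_SL_smul, coe_dilate, h00, h01, h10, h11, hc]
  push_cast
  ring

lemma gamma0Invariant_discriminantQuotient : Gamma0Invariant p (discriminantQuotient p) := by
  intro γ hγ z
  obtain ⟨γ', h10, h11, h⟩ := dilate_smul hγ
  have hd := SL_denom_ne_zero γ z
  rw [discriminantQuotient, h, discriminant_smul, discriminant_smul, coe_dilate, h11,
    show (γ' 1 0 : ℂ) * (p * z) = (γ 1 0 : ℂ) * z by rw [← h10]; push_cast; ring,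
    mul_div_mul_left _ _ (pow_ne_zero _ hd), discriminantQuotient]

lemma mdifferentiable_discriminantQuotient :
    MDifferentiable 𝓘(ℂ) 𝓘(ℂ) (discriminantQuotient p) := by
  have h : MDifferentiable 𝓘(ℂ) 𝓘(ℂ) discriminant := CuspForm.discriminant.holo'
  exact (h.comp mdifferentiable_dilate).div h discriminant_ne_zero

lemma discriminant_S_smul (z : ℍ) :
    discriminant (ModularGroup.S • z) = (z : ℂ) ^ 12 * discriminant z := by
  rw [discriminant_smul]; simp [ModularGroup.S]

lemma discriminantQuotient_fricke (z : ℍ) :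
    discriminantQuotient p (fricke p z) * discriminantQuotient p z * p ^ 12 = 1 := by
  have h1 := discriminant_ne_zero z
  have h2 := discriminant_ne_zero (dilate p z)
  have h3 := ne_zero z
  have h4 : (p : ℂ) ≠ 0 := NeZero.ne _
  rw [discriminantQuotient, dilate_fricke, fricke, discriminant_S_smul, discriminant_S_smul,
    coe_dilate, discriminantQuotient]
  field_simp

lemma exists_hasQSeries_discriminant_dilate : ∃ V : PowerSeries ℂ,
    PowerSeries.X ^ p ∣ V - 1 ∧ HasQSeries (fun z => discriminant (dilate p z) / qq z ^ p) V := by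
  obtain ⟨B, hB⟩ := exists_hasQSeries_discriminant
  have h := hB.comp_dilate (p := p)
  simp only [qq_dilate] at h
  refine ⟨_, ?_, h⟩
  rw [PowerSeries.X_pow_dvd_iff]
  intro n hn
  rw [map_sub, PowerSeries.coeff_one]
  split_ifs with h0
  · rw [h0, PowerSeries.coeff_zero_eq_constantCoeff_apply, PowerSeries.constantCoeff_expand]
    simp [discriminantTrunc]
  · rw [PowerSeries.coeff_expand_of_not_dvd, sub_zero]
    exact fun hd => h0 (Nat.eq_zero_of_dvd_of_lt hd hn)

end DiscriminantQuotient

lemma Filter.Tendsto.isBoundedAtImInfty {F : ℍ → ℂ} {c : ℂ} (h : Tendsto F atImInfty (𝓝 c)) :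
    IsBoundedAtImInfty F :=
  h.isBigO_one ℝ

/-- `ψ` has a simple pole at `∞`, with `q ψ` given by `A`, and vanishes at the cusp `0`. -/
structure IsHauptmodul (p : ℕ) [NeZero p] (ψ : ℍ → ℂ) (A : PowerSeries ℂ) : Prop where
  invariant : Gamma0Invariant p ψ
  mdifferentiable : MDifferentiable 𝓘(ℂ) 𝓘(ℂ) ψ
  hasQSeries : HasQSeries (fun z => qq z * ψ z) A
  constantCoeff : PowerSeries.constantCoeff A = 1
  exists_fricke : ∃ H, HasQSeries (fun z => ψ (fricke p z)) (PowerSeries.X * H)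

lemma IsCanonicalBasis0.exists_hasQSeries_fricke {p m : ℕ} [NeZero p] (hp : p.Prime) {f : ℍ → ℂ}
    {a : ℕ → ℤ} (h : IsCanonicalBasis0 p m f a) : ∃ H, HasQSeries (fun z => f (fricke p z)) H := by
  refine _root_.exists_hasQSeries (fun z => h.gamma0Invariant.comp_fricke.vadd_one z)
    (h.1.1.comp mdifferentiable_fricke) ?_
  have hS : ModularGroup.S ∉ CongruenceSubgroup.Gamma0 p := by
    rw [mem_Gamma0_iff_dvd]
    simpa [ModularGroup.S, Int.natCast_dvd_ofNat] using hp.one_lt.ne'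
  exact (h.isBoundedAtImInfty_smul hS).comp_tendsto tendsto_dilate

lemma IsCanonicalBasis0.exists_isHauptmodul {p : ℕ} [NeZero p] (hp : p.Prime) {f : ℍ → ℂ}
    {a : ℕ → ℤ} (h : IsCanonicalBasis0 p 1 f a) : ∃ c, IsHauptmodul p (fun z => f z - c)
      (toComplexSeries (canonicalSeries 1 a) - PowerSeries.C c * PowerSeries.X) := by
  obtain ⟨H, hH⟩ := h.exists_hasQSeries_fricke hp
  refine ⟨PowerSeries.constantCoeff H, h.gamma0Invariant.sub (Gamma0Invariant.const _),
    h.1.1.sub mdifferentiable_const, ?_, ?_, ?_⟩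
  · refine ((h.hasQSeries one_ne_zero).sub
      ((HasQSeries.const (PowerSeries.constantCoeff H)).mul (HasQSeries.monomial 1))).congr
        (fun z => ?_) |> fun h => by rwa [pow_one] at h
    ring
  · simp [canonicalSeries]
  · obtain ⟨H', hH'⟩ : PowerSeries.X ∣ H - PowerSeries.C (PowerSeries.constantCoeff H) := by
      rw [PowerSeries.X_dvd_iff]; simp
    exact ⟨H', hH' ▸ hH.sub (HasQSeries.const _)⟩

namespace IsHauptmodul

variable {p : ℕ} [NeZero p] {ψ : ℍ → ℂ} {A : PowerSeries ℂ}

lemma exists_hasQSeries_div (h : IsHauptmodul p ψ A) :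
    ∃ H, HasQSeries (fun z => ψ (fricke p z) / qq z) H := by
  obtain ⟨H, hH⟩ := h.exists_fricke
  rw [← pow_one PowerSeries.X] at hH
  exact ⟨H, hH.div_pow.congr fun z => by rw [pow_one]⟩

lemma isBoundedAtImInfty_fricke (h : IsHauptmodul p ψ A) :
    IsBoundedAtImInfty fun z => ψ (fricke p z) :=
  h.exists_fricke.choose_spec.isBoundedAtImInfty

/-- `ψ ^ (p - 1) = Δ(z) / Δ(p z)`. -/
lemma pow_mul_discriminantQuotient (h : IsHauptmodul p ψ A) (hp : p.Prime) (z : ℍ) :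
    ψ z ^ (p - 1) * discriminantQuotient p z = 1 := by
  obtain ⟨B, hB⟩ := exists_hasQSeries_discriminant
  obtain ⟨V, hV1, hV⟩ := exists_hasQSeries_discriminant_dilate (p := p)
  obtain ⟨H, hH⟩ := h.exists_hasQSeries_div
  obtain ⟨n, rfl⟩ := Nat.exists_eq_add_of_le' hp.one_le
  rw [Nat.add_sub_cancel]
  have tB := hB.tendsto
  have tV := hV.tendsto
  have hB0 : PowerSeries.constantCoeff
      (toComplexSeries discriminantTrunc + PowerSeries.X ^ 7 * B) = 1 := by
    simp [discriminantTrunc]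
  have hV0 : PowerSeries.constantCoeff V = 1 := by
    have := PowerSeries.X_dvd_iff.mp ((dvd_pow_self _ hp.ne_zero).trans hV1)
    simpa [sub_eq_zero] using this
  rw [hB0] at tB
  rw [hV0] at tV
  have t1 : Tendsto (fun z => ψ z ^ n * discriminantQuotient (n + 1) z) atImInfty (𝓝 1) := by
    have := ((h.hasQSeries.tendsto.pow n).mul tV).div tB one_ne_zero
    rw [h.constantCoeff, one_pow, one_mul, div_one] at this
    refine this.congr fun z => ?_
    have h1 := qq_ne_zero z
    have h2 := discriminant_ne_zero z
    simp only [Pi.div_apply]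
    rw [discriminantQuotient]
    field_simp
    ring
  have t2 := ((hH.tendsto.pow n).mul ((tB.div tV one_ne_zero))).mul_const
    ((((n + 1 : ℕ) : ℂ) ^ 12)⁻¹)
  obtain ⟨c, hc⟩ := ((h.invariant.pow n).mul
    gamma0Invariant_discriminantQuotient).eq_const_of_fricke hp
    ((h.mdifferentiable.pow n).mul mdifferentiable_discriminantQuotient) t1.isBoundedAtImInfty
    (by
      refine (t2.congr fun z => ?_).isBoundedAtImInfty
      have h1 := qq_ne_zero z
      have h2 := discriminant_ne_zero z
      have h3 := discriminant_ne_zero (dilate (n + 1) z)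
      have h4 : ((n + 1 : ℕ) : ℂ) ≠ 0 := NeZero.ne _
      have h5 := discriminantQuotient_fricke (p := n + 1) z
      have h6 : discriminantQuotient (n + 1) (fricke (n + 1) z) =
          discriminant z / discriminant (dilate (n + 1) z) * (((n + 1 : ℕ) : ℂ) ^ 12)⁻¹ := by
        rw [discriminantQuotient] at h5 ⊢
        rw [discriminantQuotient] at h5
        field_simp at h5 ⊢
        linear_combination h5
      simp only [Pi.div_apply]
      rw [h6, div_pow]
      field_simp
      ring)
  rw [hc, ← tendsto_nhds_unique (t1.congr hc) tendsto_const_nhds]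

/-- `ψ(-1 / (p z)) = K / ψ(z)` with `K ^ (p - 1) = p ^ 12`. -/
lemma mul_fricke (h : IsHauptmodul p ψ A) (hp : p.Prime) {K : ℕ} (hK : K ^ (p - 1) = p ^ 12)
    (hreal : ∀ z : ℍ, z.re = 0 → (ψ z).im = 0) (z : ℍ) : ψ z * ψ (fricke p z) = K := by
  obtain ⟨H, hH⟩ := h.exists_hasQSeries_div
  have hb : IsBoundedAtImInfty fun z => ψ z * ψ (fricke p z) :=
    ((h.hasQSeries.mul hH).congr fun z => by field_simp [qq_ne_zero z]).isBoundedAtImInfty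
  obtain ⟨κ, hκ⟩ := (h.invariant.mul h.invariant.comp_fricke).eq_const_of_fricke hp
    (h.mdifferentiable.mul (h.mdifferentiable.comp mdifferentiable_fricke)) hb
    (by simpa only [fricke_fricke, mul_comm] using hb)
  have hκp : κ ^ (p - 1) = p ^ 12 := by
    have h1 := h.pow_mul_discriminantQuotient hp z
    have h2 := h.pow_mul_discriminantQuotient hp (fricke p z)
    have h3 := discriminantQuotient_fricke (p := p) z
    have h4 := hκ z
    rw [← h4, mul_pow]
    linear_combination (p : ℂ) ^ 12 * ψ (fricke p z) ^ (p - 1) *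
      discriminantQuotient p (fricke p z) * h1 + (p : ℂ) ^ 12 * h2 -
      ψ z ^ (p - 1) * ψ (fricke p z) ^ (p - 1) * h3
  have hpos : 0 < (Real.sqrt p)⁻¹ := inv_pos.mpr (Real.sqrt_pos.mpr (by exact_mod_cast hp.pos))
  let w : ℍ := ⟨((Real.sqrt p)⁻¹ : ℝ) * Complex.I, by
    rw [Complex.im_ofReal_mul, Complex.I_im, mul_one]; exact hpos⟩
  have hw : fricke p w = w := by
    have hs : ((Real.sqrt p : ℝ) : ℂ) ^ 2 = p := by
      rw [← Complex.ofReal_pow, Real.sq_sqrt (Nat.cast_nonneg p), Complex.ofReal_natCast]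
    have hs0 : ((Real.sqrt p : ℝ) : ℂ) ≠ 0 := by
      simpa using hp.ne_zero
    ext
    rw [coe_fricke]
    change -1 / ((p : ℂ) * ((((Real.sqrt p)⁻¹ : ℝ) : ℂ) * Complex.I)) =
      (((Real.sqrt p)⁻¹ : ℝ) : ℂ) * Complex.I
    rw [Complex.ofReal_inv, ← hs]
    field_simp
    rw [Complex.I_sq]
  have hwr : (ψ w).im = 0 := hreal w (by
    change (((((Real.sqrt p)⁻¹ : ℝ) : ℂ) * Complex.I)).re = 0
    simp)
  obtain ⟨r, hr⟩ : ∃ r : ℝ, ψ w = r := ⟨(ψ w).re, Complex.ext rfl (by simpa using hwr)⟩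
  have hκr : κ = ((r ^ 2 : ℝ) : ℂ) := by
    rw [← hκ w, hw, hr]; push_cast; ring
  have : (r ^ 2) ^ (p - 1) = (K : ℝ) ^ (p - 1) := by
    have h5 : (K : ℝ) ^ (p - 1) = (p : ℝ) ^ 12 := by exact_mod_cast hK
    rw [h5]
    rw [hκr] at hκp
    exact_mod_cast hκp
  have h6 := (pow_left_inj₀ (sq_nonneg r) (Nat.cast_nonneg K)
    (Nat.sub_ne_zero_of_lt hp.one_lt)).mp this
  rw [hκ, hκr, h6, Complex.ofReal_natCast]

end IsHauptmodul

lemma PowerSeries.dvd_sub_of_dvd_pow_sub_pow {A B d : PowerSeries ℂ}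
    (hA : PowerSeries.constantCoeff A = 1) (hB : PowerSeries.constantCoeff B = 1) {n : ℕ}
    (hn : n ≠ 0) (h : d ∣ A ^ n - B ^ n) : d ∣ A - B := by
  rw [← (Commute.all A B).geom_sum₂_mul] at h
  refine (IsUnit.dvd_mul_left ?_).mp h
  rw [PowerSeries.isUnit_iff_constantCoeff]
  simp [hA, hB, hn]

namespace IsHauptmodul

variable {p : ℕ} [NeZero p] {ψ : ℍ → ℂ} {A : PowerSeries ℂ}

lemma X_pow_dvd_sub (h : IsHauptmodul p ψ A) (hp : p.Prime) (hp7 : p ≤ 7) {a : PowerSeries ℤ}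
    (ha : PowerSeries.constantCoeff a = 1)
    (hd : PowerSeries.X ^ p ∣ a ^ (p - 1) - discriminantTrunc) :
    PowerSeries.X ^ p ∣ A - toComplexSeries a := by
  obtain ⟨B, hB⟩ := exists_hasQSeries_discriminant
  obtain ⟨V, hV1, hV⟩ := exists_hasQSeries_discriminant_dilate (p := p)
  have ha' : PowerSeries.constantCoeff (toComplexSeries a) = 1 := by
    rw [← PowerSeries.coeff_zero_eq_constantCoeff_apply, PowerSeries.coeff_map,
      PowerSeries.coeff_zero_eq_constantCoeff_apply, ha, map_one]
  have e : A ^ (p - 1) * V = toComplexSeries discriminantTrunc + PowerSeries.X ^ 7 * B := by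
    refine (((h.hasQSeries.pow (p - 1)).mul hV).congr fun z => ?_).unique hB
    have h1 := h.pow_mul_discriminantQuotient hp z
    have h2 := qq_ne_zero z
    have h3 : qq z ^ p = qq z ^ (p - 1) * qq z := by
      rw [← pow_succ, Nat.sub_add_cancel hp.one_le]
    rw [discriminantQuotient, mul_div_assoc', div_eq_iff (discriminant_ne_zero z), one_mul] at h1
    rw [h3, mul_pow, ← h1]
    field_simp
  refine PowerSeries.dvd_sub_of_dvd_pow_sub_pow h.constantCoeff ha'
    (Nat.sub_ne_zero_of_lt hp.one_lt) ?_
  have hd' := map_dvd toComplexSeries hd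
  simp only [map_pow, PowerSeries.map_X, map_sub] at hd'
  have e' : A ^ (p - 1) - toComplexSeries a ^ (p - 1) = PowerSeries.X ^ 7 * B -
      A ^ (p - 1) * (V - 1) - (toComplexSeries a ^ (p - 1) - toComplexSeries discriminantTrunc) := by
    linear_combination e
  rw [e']
  exact dvd_sub (dvd_sub ((pow_dvd_pow _ hp7).mul_right _) (hV1.mul_left _)) hd'

/-- The level one Hauptmodul as a polynomial in `ψ` and `ψ ∘ fricke p`. -/
lemma exists_eq_add_sum (h : IsHauptmodul p ψ A) (hp : p.Prime) {J : ℍ → ℂ} {b : ℕ → ℤ}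
    (hJ : IsCanonicalBasis0 1 1 J b) {c : ℕ → ℤ}
    (hc : PowerSeries.X ^ p ∣ ∑ k ∈ Finset.Icc 1 p,
      PowerSeries.C (c k : ℂ) * PowerSeries.X ^ (p - k) * A ^ k - 1) :
    ∃ C : ℂ, ∀ z, J z = ψ z + ∑ k ∈ Finset.Icc 1 p, (c k : ℂ) * ψ (fricke p z) ^ k + C := by
  have hJinv : Gamma0Invariant p J := fun γ _ z =>
    hJ.gamma0Invariant γ (mem_Gamma0_iff_dvd.mpr (by simp)) z
  have hJf : ∀ z, J (fricke p z) = J (dilate p z) := fun z =>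
    hJ.gamma0Invariant ModularGroup.S (mem_Gamma0_iff_dvd.mpr (by simp)) _
  have hJq := hJ.hasQSeries one_ne_zero
  have hJd := hJq.comp_dilate (p := p)
  simp only [pow_one, qq_dilate] at hJq hJd
  have hJ1 : PowerSeries.constantCoeff (toComplexSeries (canonicalSeries 1 b)) = 1 := by
    simp [canonicalSeries]
  have hsum : HasQSeries (fun z => ∑ k ∈ Finset.Icc 1 p,
      (c k : ℂ) * qq z ^ (p - k) * (qq z * ψ z) ^ k) (∑ k ∈ Finset.Icc 1 p,
      PowerSeries.C (c k : ℂ) * PowerSeries.X ^ (p - k) * A ^ k) :=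
    HasQSeries.sum _ fun k _ =>
      ((HasQSeries.const _).mul (HasQSeries.monomial _)).mul (h.hasQSeries.pow k)
  have hexp : PowerSeries.X ^ p ∣ PowerSeries.expand p (NeZero.ne p)
      (toComplexSeries (canonicalSeries 1 b)) - 1 := by
    rw [PowerSeries.X_pow_dvd_iff]
    intro n hn
    rw [map_sub, PowerSeries.coeff_one]
    split_ifs with h0
    · rw [h0, PowerSeries.coeff_zero_eq_constantCoeff_apply, PowerSeries.constantCoeff_expand,
        hJ1, sub_self]
    · rw [PowerSeries.coeff_expand_of_not_dvd, sub_zero]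
      exact fun hd => h0 (Nat.eq_zero_of_dvd_of_lt hd hn)
  obtain ⟨W, hW⟩ := dvd_sub hexp hc
  have hcusp : IsBoundedAtImInfty fun z =>
      J (dilate p z) - ∑ k ∈ Finset.Icc 1 p, (c k : ℂ) * ψ z ^ k := by
    have h1 := hJd.sub hsum
    rw [← sub_sub_sub_cancel_right _ _ 1, hW] at h1
    refine (h1.div_pow.congr fun z => ?_).isBoundedAtImInfty
    rw [sub_div, Finset.sum_div, mul_div_cancel_left₀ _ (pow_ne_zero _ (qq_ne_zero z))]
    congr 1
    refine Finset.sum_congr rfl fun k hk => ?_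
    have h2 := qq_ne_zero z
    have h3 : qq z ^ p = qq z ^ (p - k) * qq z ^ k := by
      rw [← pow_add, Nat.sub_add_cancel (Finset.mem_Icc.mp hk).2]
    rw [h3, mul_pow]
    field_simp
  have hinf : IsBoundedAtImInfty fun z => J z - ψ z := by
    obtain ⟨W', hW'⟩ : PowerSeries.X ∣ toComplexSeries (canonicalSeries 1 b) - A := by
      rw [PowerSeries.X_dvd_iff, map_sub, hJ1, h.constantCoeff, sub_self]
    have h1 := hJq.sub h.hasQSeries
    rw [hW', ← pow_one PowerSeries.X] at h1
    refine (h1.div_pow.congr fun z => ?_).isBoundedAtImInfty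
    field_simp [qq_ne_zero z]
  have hψf := h.isBoundedAtImInfty_fricke
  have hdiff : MDifferentiable 𝓘(ℂ) 𝓘(ℂ) fun z => ∑ k ∈ Finset.Icc 1 p, (c k : ℂ) * ψ z ^ k := by
    have := MDifferentiable.sum (t := Finset.Icc 1 p) (f := fun k z => (c k : ℂ) * ψ z ^ k)
      (I := 𝓘(ℂ)) fun k _ => mdifferentiable_const.mul (h.mdifferentiable.pow k)
    rwa [Finset.sum_fn] at this
  obtain ⟨C, hC⟩ := Gamma0Invariant.eq_const_of_fricke hp
    (F := fun z => J (fricke p z) - ψ (fricke p z) - ∑ k ∈ Finset.Icc 1 p, (c k : ℂ) * ψ z ^ k)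
    ((hJinv.comp_fricke.sub h.invariant.comp_fricke).sub
      (Gamma0Invariant.sum _ fun k _ => (Gamma0Invariant.const _).mul (h.invariant.pow k)))
    (((hJ.1.1.comp mdifferentiable_fricke).sub
      (h.mdifferentiable.comp mdifferentiable_fricke)).sub hdiff)
    (by
      refine (hcusp.fun_sub hψf).congr_left fun z => ?_
      rw [hJf]; ring)
    (by
      simp only [fricke_fricke]
      exact hinf.fun_sub (IsBoundedAtImInfty.fun_sum _ fun k _ =>
        (IsBoundedAtImInfty.const _).fun_mul (hψf.fun_pow k)))
  refine ⟨C, fun z => ?_⟩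
  have := hC (fricke p z)
  simp only [fricke_fricke] at this
  linear_combination this

end IsHauptmodul

lemma IsCanonicalBasis0.im_eq_zero {N m : ℕ} {f : ℍ → ℂ} {a : ℕ → ℤ} (h : IsCanonicalBasis0 N m f a)
    {z : ℍ} (hz : z.re = 0) : (f z).im = 0 := by
  obtain ⟨r, hr⟩ : ∃ r : ℝ, qq z = r := by
    refine ⟨Real.exp (-2 * Real.pi * z.im), ?_⟩
    have : (z : ℂ) = z.im * Complex.I := Complex.ext (by simpa using hz) (by simp)
    rw [qq, this, Complex.ofReal_exp]
    congr 1
    push_cast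
    linear_combination 2 * (Real.pi : ℂ) * z.im * Complex.I_sq
  rw [h.2 z, hr]
  have : ((r : ℂ) ^ (-(m : ℤ)) + ∑' n : ℕ, (a (n + 1) : ℂ) * (r : ℂ) ^ (n + 1)) =
      ((r ^ (-(m : ℤ)) + ∑' n : ℕ, (a (n + 1) : ℝ) * r ^ (n + 1) : ℝ) : ℂ) := by
    push_cast
    rfl
  rw [this, Complex.ofReal_im]

lemma IsHauptmodul.series_mul_pow {p : ℕ} [NeZero p] {ψ : ℍ → ℂ} {A : PowerSeries ℂ}
    (h : IsHauptmodul p ψ A) {K : ℕ} (hK : ∀ z, ψ z * ψ (fricke p z) = K)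
    {J : ℍ → ℂ} {B : PowerSeries ℂ} (hJ : HasQSeries (fun z => qq z * J z) B) {c : ℕ → ℤ} {C : ℂ}
    (hC : ∀ z, J z = ψ z + ∑ k ∈ Finset.Icc 1 p, (c k : ℂ) * ψ (fricke p z) ^ k + C) :
    B * A ^ p = A ^ (p + 1) + ∑ k ∈ Finset.Icc 1 p,
      PowerSeries.C ((c k * K ^ k : ℤ) : ℂ) * PowerSeries.X ^ (k + 1) * A ^ (p - k) +
        PowerSeries.C C * PowerSeries.X ^ 1 * A ^ p := by
  have hA := h.hasQSeries
  refine (hJ.mul (hA.pow p)).unique ((((hA.pow (p + 1)).add (HasQSeries.sum _ fun k _ =>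
    ((HasQSeries.const _).mul (HasQSeries.monomial _)).mul (hA.pow (p - k)))).add
    (((HasQSeries.const C).mul (HasQSeries.monomial 1)).mul (hA.pow p))).congr fun z => ?_)
  have hs : ∑ k ∈ Finset.Icc 1 p,
      ((c k * K ^ k : ℤ) : ℂ) * qq z ^ (k + 1) * (qq z * ψ z) ^ (p - k) =
      qq z * (qq z * ψ z) ^ p * ∑ k ∈ Finset.Icc 1 p, (c k : ℂ) * ψ (fricke p z) ^ k := by
    rw [Finset.mul_sum]
    refine Finset.sum_congr rfl fun k hk => ?_
    have h1 : (qq z * ψ z) ^ p = (qq z * ψ z) ^ (p - k) * (qq z * ψ z) ^ k := by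
      rw [← pow_add, Nat.sub_add_cancel (Finset.mem_Icc.mp hk).2]
    rw [h1]
    push_cast
    rw [← hK z]
    ring
  rw [hs, hC z]
  ring

lemma reduceSeries_eq_of_mul_pow_eq {M p : ℕ} {B A : PowerSeries ℤ} {d : ℕ → ℤ} {C : ℂ}
    (hA : PowerSeries.constantCoeff A = 1) (hM : ∀ k ∈ Finset.Icc 1 p, (M : ℤ) ∣ d k)
    (h : toComplexSeries B * toComplexSeries A ^ p = toComplexSeries A ^ (p + 1) +
      ∑ k ∈ Finset.Icc 1 p, PowerSeries.C (d k : ℂ) * PowerSeries.X ^ (k + 1) *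
        toComplexSeries A ^ (p - k) + PowerSeries.C C * PowerSeries.X ^ 1 * toComplexSeries A ^ p) :
    ∃ e : ℤ, reduceSeries M B = reduceSeries M (A + PowerSeries.C e * PowerSeries.X) := by
  have hu : IsUnit (toComplexSeries A ^ p) := by
    refine IsUnit.pow _ (IsUnit.map _ ?_)
    rw [PowerSeries.isUnit_iff_constantCoeff, hA]
    exact isUnit_one
  have h2 : PowerSeries.X ^ 2 ∣ toComplexSeries B - toComplexSeries A -
      PowerSeries.C C * PowerSeries.X := by
    refine hu.dvd_mul_right.mp ?_
    have : (toComplexSeries B - toComplexSeries A - PowerSeries.C C * PowerSeries.X) *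
        toComplexSeries A ^ p = ∑ k ∈ Finset.Icc 1 p, PowerSeries.C (d k : ℂ) *
          PowerSeries.X ^ (k + 1) * toComplexSeries A ^ (p - k) := by
      linear_combination h
    rw [this]
    refine Finset.dvd_sum fun k hk => Dvd.dvd.mul_right (Dvd.dvd.mul_left ?_ _) _
    exact pow_dvd_pow _ (by have := (Finset.mem_Icc.mp hk).1; omega)
  set e : ℤ := PowerSeries.coeff 1 B - PowerSeries.coeff 1 A with he
  have hCe : C = e := by
    have := PowerSeries.X_pow_dvd_iff.mp h2 1 one_lt_two
    simp only [map_sub, PowerSeries.coeff_map, PowerSeries.coeff_C_mul, PowerSeries.coeff_one_X,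
      mul_one, eq_intCast] at this
    rw [he]
    push_cast
    linear_combination -this
  have hZ : B * A ^ p = A ^ (p + 1) + ∑ k ∈ Finset.Icc 1 p,
      PowerSeries.C (d k) * PowerSeries.X ^ (k + 1) * A ^ (p - k) +
        PowerSeries.C e * PowerSeries.X ^ 1 * A ^ p := by
    apply toComplexSeries_injective
    simp only [map_add, map_mul, map_pow, map_sum, PowerSeries.map_C, PowerSeries.map_X,
      eq_intCast (Int.castRingHom ℂ)]
    rw [h, hCe]
  refine ⟨e, ?_⟩
  have hu' : IsUnit (reduceSeries M A ^ p) := by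
    refine IsUnit.pow _ (IsUnit.map _ ?_)
    rw [PowerSeries.isUnit_iff_constantCoeff, hA]
    exact isUnit_one
  have hr := congrArg (reduceSeries M) hZ
  simp only [map_add, map_mul, map_pow, map_sum, PowerSeries.map_C, PowerSeries.map_X] at hr
  rw [Finset.sum_eq_zero fun k hk => by
    rw [eq_intCast, (ZMod.intCast_zmod_eq_zero_iff_dvd _ _).mpr (hM k hk), map_zero, zero_mul,
      zero_mul]] at hr
  refine hu'.mul_left_injective ?_
  simp only [map_add, map_mul, PowerSeries.map_C, PowerSeries.map_X]
  linear_combination hr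

/-- The congruence between the Hauptmoduln of level `1` and `p`, from the beginning `a` of the
expansion of `q (Δ(z) / Δ(p z)) ^ (1 / (p - 1))`, the coefficients `c` of the polynomial
expressing `j`, and the constant `K = p ^ (12 / (p - 1))`. -/
lemma reduceSeries_canonicalSeries_eq {p M : ℕ} [NeZero p] (K : ℕ) (a : PowerSeries ℤ) (c : ℕ → ℤ)
    (hp : p.Prime) (hp7 : p ≤ 7) (ha : PowerSeries.constantCoeff a = 1)
    (hd : PowerSeries.X ^ p ∣ a ^ (p - 1) - discriminantTrunc)
    (hc : PowerSeries.X ^ p ∣ ∑ k ∈ Finset.Icc 1 p,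
      PowerSeries.C (c k) * PowerSeries.X ^ (p - k) * a ^ k - 1)
    (hK : K ^ (p - 1) = p ^ 12) (hM : ∀ k ∈ Finset.Icc 1 p, (M : ℤ) ∣ c k * K ^ k)
    {J P : ℍ → ℂ} {b b' : ℕ → ℤ} (hJ : IsCanonicalBasis0 1 1 J b) (hP : IsCanonicalBasis0 p 1 P b') :
    reduceSeries M (canonicalSeries 1 b) = reduceSeries M (canonicalSeries 1 b') := by
  obtain ⟨c₀, h⟩ := hP.exists_isHauptmodul hp
  have hAa := h.X_pow_dvd_sub hp hp7 ha hd
  obtain ⟨s, rfl⟩ : ∃ s : ℤ, c₀ = s := by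
    refine ⟨-PowerSeries.coeff 1 a, ?_⟩
    have := PowerSeries.X_pow_dvd_iff.mp hAa 1 hp.one_lt
    simp only [map_sub, PowerSeries.coeff_map, coeff_canonicalSeries_self one_ne_zero, map_zero,
      PowerSeries.coeff_C_mul, PowerSeries.coeff_one_X, mul_one, eq_intCast] at this
    push_cast
    linear_combination -this
  set A : PowerSeries ℤ := canonicalSeries 1 b' - PowerSeries.C s * PowerSeries.X with hA
  have hAC : toComplexSeries (canonicalSeries 1 b') - PowerSeries.C (s : ℂ) * PowerSeries.X =
      toComplexSeries A := by
    simp only [hA, map_sub, map_mul, PowerSeries.map_C, PowerSeries.map_X,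
      eq_intCast (Int.castRingHom ℂ)]
  rw [hAC] at h hAa
  have hreal : ∀ z : ℍ, z.re = 0 → (P z - s).im = 0 := fun z hz => by
    rw [Complex.sub_im, hP.im_eq_zero hz, Complex.intCast_im, sub_zero]
  have hcA : PowerSeries.X ^ p ∣ ∑ k ∈ Finset.Icc 1 p,
      PowerSeries.C (c k : ℂ) * PowerSeries.X ^ (p - k) * toComplexSeries A ^ k - 1 := by
    have hc' := map_dvd toComplexSeries hc
    simp only [map_sub, map_sum, map_mul, map_pow, PowerSeries.map_C, PowerSeries.map_X, map_one,
      eq_intCast (Int.castRingHom ℂ)] at hc'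
    refine (dvd_iff_dvd_of_dvd_sub ?_).mpr hc'
    rw [sub_sub_sub_cancel_right, ← Finset.sum_sub_distrib]
    refine Finset.dvd_sum fun k _ => ?_
    rw [← mul_sub]
    exact (hAa.trans (sub_dvd_pow_sub_pow _ _ k)).mul_left _
  obtain ⟨C, hC⟩ := h.exists_eq_add_sum hp hJ hcA
  have hJq := hJ.hasQSeries one_ne_zero
  simp only [pow_one] at hJq
  obtain ⟨e, he⟩ := reduceSeries_eq_of_mul_pow_eq (by simp [hA, canonicalSeries]) hM
    (h.series_mul_pow (h.mul_fricke hp hK hreal) hJq hC)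
  have h1 := congrArg (PowerSeries.coeff 1) he
  simp only [hA, PowerSeries.coeff_map, map_add, map_sub, map_mul, PowerSeries.coeff_C_mul,
    coeff_canonicalSeries_self one_ne_zero, PowerSeries.coeff_one_X, PowerSeries.map_C,
    PowerSeries.map_X, map_zero, mul_one, zero_sub] at h1
  rw [he, hA, ← sub_eq_zero]
  simp only [map_add, map_sub, map_mul, PowerSeries.map_C, PowerSeries.map_X]
  have h3 : (PowerSeries.C (Int.castRingHom (ZMod M) e) : PowerSeries (ZMod M)) =
      PowerSeries.C (Int.castRingHom (ZMod M) s) := by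
    rw [← sub_eq_zero, ← map_sub, sub_eq_add_neg, add_comm, ← h1, map_zero]
  rw [h3]
  ring

lemma level_two_dvd {R : Type*} [CommRing R] (x a : R)
    (ha : a = 1 - 24 * x) :
    x ^ 2 ∣ a ^ 1 -
      (1 - 24 * x + 252 * x ^ 2 - 1472 * x ^ 3 + 4830 * x ^ 4 - 6048 * x ^ 5 -
      16744 * x ^ 6) ∧
    x ^ 2 ∣
      48 * x * a + a ^ 2 - 1 := by
  subst ha
  refine ⟨⟨-252 + 1472 * x - 4830 * x ^ 2 + 6048 * x ^ 3 + 16744 * x ^ 4, ?_⟩,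
    ⟨-576, ?_⟩⟩ <;> ring

lemma reduceSeries_level_two {J P : ℍ → ℂ} {b b' : ℕ → ℤ} (hJ : IsCanonicalBasis0 1 1 J b)
    (hP : IsCanonicalBasis0 2 1 P b') :
    reduceSeries (2 ^ 16) (canonicalSeries 1 b) = reduceSeries (2 ^ 16) (canonicalSeries 1 b') := by
  obtain ⟨a, ha⟩ : ∃ a : PowerSeries ℤ,
      a = 1 - 24 * PowerSeries.X := ⟨_, rfl⟩
  obtain ⟨hd, hc⟩ := level_two_dvd PowerSeries.X a ha
  refine reduceSeries_canonicalSeries_eq 4096 a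
    (fun k => [0, 48, 1].getD k 0) (by norm_num)
    (by norm_num) (by simp [ha]) hd (hc.trans (dvd_of_eq ?_)) (by norm_num) (by decide +kernel) hJ hP
  simp [Finset.sum_Icc_succ_top]

lemma level_three_dvd {R : Type*} [CommRing R] (x a : R)
    (ha : a = 1 - 12 * x + 54 * x ^ 2) :
    x ^ 3 ∣ a ^ 2 -
      (1 - 24 * x + 252 * x ^ 2 - 1472 * x ^ 3 + 4830 * x ^ 4 - 6048 * x ^ 5 -
      16744 * x ^ 6) ∧
    x ^ 3 ∣
      270 * x ^ 2 * a + 36 * x * a ^ 2 + a ^ 3 - 1 := by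
  subst ha
  refine ⟨⟨176 - 1914 * x + 6048 * x ^ 2 + 16744 * x ^ 3, ?_⟩,
    ⟨216 + 157464 * x ^ 3, ?_⟩⟩ <;> ring

lemma reduceSeries_level_three {J P : ℍ → ℂ} {b b' : ℕ → ℤ} (hJ : IsCanonicalBasis0 1 1 J b)
    (hP : IsCanonicalBasis0 3 1 P b') :
    reduceSeries (3 ^ 9) (canonicalSeries 1 b) = reduceSeries (3 ^ 9) (canonicalSeries 1 b') := by
  obtain ⟨a, ha⟩ : ∃ a : PowerSeries ℤ,
      a = 1 - 12 * PowerSeries.X + 54 * PowerSeries.X ^ 2 := ⟨_, rfl⟩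
  obtain ⟨hd, hc⟩ := level_three_dvd PowerSeries.X a ha
  refine reduceSeries_canonicalSeries_eq 729 a
    (fun k => [0, 270, 36, 1].getD k 0) (by norm_num)
    (by norm_num) (by simp [ha]) hd (hc.trans (dvd_of_eq ?_)) (by norm_num) (by decide +kernel) hJ hP
  simp [Finset.sum_Icc_succ_top]

lemma level_five_dvd {R : Type*} [CommRing R] (x a : R)
    (ha : a = 1 - 6 * x + 9 * x ^ 2 + 10 * x ^ 3 - 30 * x ^ 4) :
    x ^ 5 ∣ a ^ 4 -
      (1 - 24 * x + 252 * x ^ 2 - 1472 * x ^ 3 + 4830 * x ^ 4 - 6048 * x ^ 5 -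
      16744 * x ^ 6) ∧
    x ^ 5 ∣
      1575 * x ^ 4 * a + 1300 * x ^ 3 * a ^ 2 + 315 * x ^ 2 * a ^ 3 + 30 * x * a ^ 4 + a ^ 5 - 1 := by
  subst ha
  refine ⟨⟨-44 * x + 85104 * x ^ 2 - 116559 * x ^ 3 - 115880 * x ^ 4 + 581520 * x ^ 5 -
    514800 * x ^ 6 - 632600 * x ^ 7 + 1500000 * x ^ 8 - 432000 * x ^ 9 -
    1080000 * x ^ 10 + 810000 * x ^ 11, ?_⟩,
    ⟨-36 - 1500 * x ^ 2 - 3150 * x ^ 3 - 12550 * x ^ 4 + 132699 * x ^ 5 - 40950 * x ^ 6 -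
    596650 * x ^ 7 - 519000 * x ^ 8 - 1224000 * x ^ 9 + 11170000 * x ^ 10 +
    4980000 * x ^ 11 - 39600000 * x ^ 12 + 9450000 * x ^ 13 + 40500000 * x ^ 14 -
    24300000 * x ^ 15, ?_⟩⟩ <;> ring

lemma reduceSeries_level_five {J P : ℍ → ℂ} {b b' : ℕ → ℤ} (hJ : IsCanonicalBasis0 1 1 J b)
    (hP : IsCanonicalBasis0 5 1 P b') :
    reduceSeries (5 ^ 5) (canonicalSeries 1 b) = reduceSeries (5 ^ 5) (canonicalSeries 1 b') := by
  obtain ⟨a, ha⟩ : ∃ a : PowerSeries ℤ,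
      a = 1 - 6 * PowerSeries.X + 9 * PowerSeries.X ^ 2 + 10 * PowerSeries.X ^ 3 -
        30 * PowerSeries.X ^ 4 := ⟨_, rfl⟩
  obtain ⟨hd, hc⟩ := level_five_dvd PowerSeries.X a ha
  refine reduceSeries_canonicalSeries_eq 125 a
    (fun k => [0, 1575, 1300, 315, 30, 1].getD k 0) (by norm_num)
    (by norm_num) (by simp [ha]) hd (hc.trans (dvd_of_eq ?_)) (by norm_num) (by decide +kernel) hJ hP
  simp [Finset.sum_Icc_succ_top]

lemma level_seven_dvd {R : Type*} [CommRing R] (x a : R)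
    (ha : a = 1 - 4 * x + 2 * x ^ 2 + 8 * x ^ 3 - 5 * x ^ 4 - 4 * x ^ 5 - 10 * x ^ 6) :
    x ^ 7 ∣ a ^ 6 -
      (1 - 24 * x + 252 * x ^ 2 - 1472 * x ^ 3 + 4830 * x ^ 4 - 6048 * x ^ 5 -
      16744 * x ^ 6) ∧
    x ^ 7 ∣
      4018 * x ^ 6 * a + 8624 * x ^ 5 * a ^ 2 +
      5915 * x ^ 4 * a ^ 3 + 1904 * x ^ 3 * a ^ 4 + 322 * x ^ 2 * a ^ 5 + 28 * x * a ^ 6 + a ^ 7 - 1 := by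
  subst ha
  refine ⟨⟨84432 - 112737 * x - 123000 * x ^ 2 + 561828 * x ^ 3 - 405648 * x ^ 4 -
    703936 * x ^ 5 + 993216 * x ^ 6 + 547440 * x ^ 7 - 241760 * x ^ 8 - 2760897 * x ^ 9 +
    353016 * x ^ 10 + 5880644 * x ^ 11 - 948960 * x ^ 12 - 5629242 * x ^ 13 -
    5187040 * x ^ 14 + 6538200 * x ^ 15 + 12011280 * x ^ 16 - 3903535 * x ^ 17 -
    11609064 * x ^ 18 - 9500964 * x ^ 19 + 8811312 * x ^ 20 + 14450748 * x ^ 21 +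
    3088320 * x ^ 22 - 6903904 * x ^ 23 - 11698560 * x ^ 24 - 1866000 * x ^ 25 +
    2480000 * x ^ 26 + 5400000 * x ^ 27 + 2400000 * x ^ 28 + 1000000 * x ^ 29, ?_⟩,
    ⟨-88 - 420 * x ^ 2 - 2254 * x ^ 3 - 112 * x ^ 4 - 11074 * x ^ 5 - 26656 * x ^ 6 +
    207776 * x ^ 7 - 171752 * x ^ 8 - 158228 * x ^ 9 + 251020 * x ^ 10 -
    2292486 * x ^ 11 + 449344 * x ^ 12 + 1128771 * x ^ 13 + 9270780 * x ^ 14 +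
    13401192 * x ^ 15 - 870408 * x ^ 16 - 8571465 * x ^ 17 - 61549096 * x ^ 18 -
    61587750 * x ^ 19 - 38126760 * x ^ 20 + 96516751 * x ^ 21 + 224459844 * x ^ 22 +
    167564194 * x ^ 23 - 9971696 * x ^ 24 - 316422036 * x ^ 25 - 282290064 * x ^ 26 -
    154741720 * x ^ 27 + 177257216 * x ^ 28 + 214403280 * x ^ 29 + 184049600 * x ^ 30 +
    2940000 * x ^ 31 - 50400000 * x ^ 32 - 68600000 * x ^ 33 - 28000000 * x ^ 34 -
    10000000 * x ^ 35, ?_⟩⟩ <;> ring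

lemma reduceSeries_level_seven {J P : ℍ → ℂ} {b b' : ℕ → ℤ} (hJ : IsCanonicalBasis0 1 1 J b)
    (hP : IsCanonicalBasis0 7 1 P b') :
    reduceSeries (7 ^ 4) (canonicalSeries 1 b) = reduceSeries (7 ^ 4) (canonicalSeries 1 b') := by
  obtain ⟨a, ha⟩ : ∃ a : PowerSeries ℤ,
      a = 1 - 4 * PowerSeries.X + 2 * PowerSeries.X ^ 2 + 8 * PowerSeries.X ^ 3 -
        5 * PowerSeries.X ^ 4 - 4 * PowerSeries.X ^ 5 - 10 * PowerSeries.X ^ 6 := ⟨_, rfl⟩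
  obtain ⟨hd, hc⟩ := level_seven_dvd PowerSeries.X a ha
  refine reduceSeries_canonicalSeries_eq 49 a
    (fun k => [0, 4018, 8624, 5915, 1904, 322, 28, 1].getD k 0) (by norm_num)
    (by norm_num) (by simp [ha]) hd (hc.trans (dvd_of_eq ?_)) (by norm_num) (by decide +kernel) hJ hP
  simp [Finset.sum_Icc_succ_top]

/-- For every `m > 0`, the canonical basis elements satisfy
`f_{0,m}⁽¹⁾ ≡ f_{0,m}⁽²⁾ (mod 2¹⁶)`, `≡ f_{0,m}⁽³⁾ (mod 3⁹)`,
`≡ f_{0,m}⁽⁵⁾ (mod 5⁵)`, `≡ f_{0,m}⁽⁷⁾ (mod 7⁴)` coefficientwise. -/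
theorem basis_congruences (f1 f2 f3 f5 f7 : ℕ → ℍ → ℂ)
    (a1 a2 a3 a5 a7 : ℕ → ℕ → ℤ)
    (h1 : ∀ m, IsCanonicalBasis0 1 m (f1 m) (a1 m))
    (h2 : ∀ m, IsCanonicalBasis0 2 m (f2 m) (a2 m))
    (h3 : ∀ m, IsCanonicalBasis0 3 m (f3 m) (a3 m))
    (h5 : ∀ m, IsCanonicalBasis0 5 m (f5 m) (a5 m))
    (h7 : ∀ m, IsCanonicalBasis0 7 m (f7 m) (a7 m)) :
    ∀ m, 0 < m → ∀ n, 1 ≤ n →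
      (2 : ℤ) ^ 16 ∣ (a1 m n - a2 m n) ∧
      (3 : ℤ) ^ 9 ∣ (a1 m n - a3 m n) ∧
      (5 : ℤ) ^ 5 ∣ (a1 m n - a5 m n) ∧
      (7 : ℤ) ^ 4 ∣ (a1 m n - a7 m n) := by
  intro m hm n hn
  refine ⟨?_, ?_, ?_, ?_⟩
  · exact_mod_cast IsCanonicalBasis0.dvd_sub h1 h2 (reduceSeries_level_two (h1 1) (h2 1)) hm hn
  · exact_mod_cast IsCanonicalBasis0.dvd_sub h1 h3 (reduceSeries_level_three (h1 1) (h3 1)) hm hn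
  · exact_mod_cast IsCanonicalBasis0.dvd_sub h1 h5 (reduceSeries_level_five (h1 1) (h5 1)) hm hn
  · exact_mod_cast IsCanonicalBasis0.dvd_sub h1 h7 (reduceSeries_level_seven (h1 1) (h7 1)) hm hn
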